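/- arXiv:1904.00563 — 2 statements merged into one kernel-verified Lean document; each statement's English description precedes it below -/
import Mathlib

section
/- Let G be a bipartite planar quadrangulation with minimum degree at least 3 that is not isomorphic to the 3-cube Q₃. Then G admits no proper orientation with maximum indegree at most 2, and hence its proper orientation number equals 3. -/
/-- An orientation of a simple graph: a relation choosing exactly one
direction for each edge, and nothing else. -/
def IsOrientation {V : Type*} (G : SimpleGraph V) (o : V → V → Prop) : Prop :=
  (∀ u v, G.Adj u v ↔ (o u v ∨ o v u)) ∧ (∀ u v, o u v → ¬ o v u)

/-- Indegree of a vertex in an orientation. -/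
noncomputable def inDeg {V : Type*} (o : V → V → Prop) (v : V) : ℕ :=
  {u | o u v}.ncard

/-- A proper orientation: adjacent vertices get distinct indegrees. -/
def IsProper {V : Type*} (G : SimpleGraph V) (o : V → V → Prop) : Prop :=
  ∀ u v, G.Adj u v → inDeg o u ≠ inDeg o v

/-- A graph is bipartite iff it admits a proper 2-coloring. -/
def IsBipartite {V : Type*} (G : SimpleGraph V) : Prop :=
  ∃ c : V → Bool, ∀ u v, G.Adj u v → c u ≠ c v

/-- A drawing of `G` in the plane: vertices are distinct points, each edge is a
simple arc between the images of its endpoints, arcs pass through no other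
vertex points, arcs of distinct edges meet only in common endpoints, and the
two directions of an edge trace the same arc. -/
structure PlaneDrawing {V : Type*} (G : SimpleGraph V) where
  vert : V → ℝ × ℝ
  vert_inj : Function.Injective vert
  arc : ∀ ⦃u v : V⦄, G.Adj u v → Path (vert u) (vert v)
  arc_inj : ∀ ⦃u v : V⦄ (h : G.Adj u v), Function.Injective (arc h)
  arc_symm : ∀ ⦃u v : V⦄ (h : G.Adj u v), Set.range ⇑(arc h.symm) = Set.range ⇑(arc h)
  arc_vert : ∀ ⦃u v : V⦄ (h : G.Adj u v) (w : V),
    vert w ∈ Set.range ⇑(arc h) → w = u ∨ w = v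
  arc_disjoint : ∀ ⦃u v u' v' : V⦄ (h : G.Adj u v) (h' : G.Adj u' v'),
    s(u, v) ≠ s(u', v') →
    Set.range ⇑(arc h) ∩ Set.range ⇑(arc h') ⊆
      ({vert u, vert v} : Set (ℝ × ℝ)) ∩ {vert u', vert v'}

/-- A graph is planar iff it admits a plane drawing. -/
def IsPlanar {V : Type*} (G : SimpleGraph V) : Prop :=
  Nonempty (PlaneDrawing G)

/-- The subset of the plane covered by a drawing. -/
def PlaneDrawing.image {V : Type*} {G : SimpleGraph V} (D : PlaneDrawing G) :
    Set (ℝ × ℝ) :=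
  Set.range D.vert ∪ ⋃ (u : V) (v : V) (h : G.Adj u v), Set.range ⇑(D.arc h)

/-- A quadrangulation: a connected graph admitting a plane drawing in which
every face (connected component of the complement of the drawing) is bounded
by a 4-cycle of the graph. -/
def IsQuadrangulation {V : Type*} (G : SimpleGraph V) : Prop :=
  G.Connected ∧
  ∃ D : PlaneDrawing G, ∀ x ∉ D.image,
    ∃ (a b c d : V) (hab : G.Adj a b) (hbc : G.Adj b c) (hcd : G.Adj c d)
      (hda : G.Adj d a), a ≠ c ∧ b ≠ d ∧
      frontier (connectedComponentIn D.imageᶜ x) =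
        Set.range ⇑(D.arc hab) ∪ Set.range ⇑(D.arc hbc) ∪
          Set.range ⇑(D.arc hcd) ∪ Set.range ⇑(D.arc hda)


/-- The 3-dimensional hypercube graph. -/
def cubeGraph : SimpleGraph (Fin 3 → Bool) :=
  SimpleGraph.fromRel (fun u v => {i | u i ≠ v i}.ncard = 1)

namespace QPO
open Set Topology Filter

/-- The coordinate map from the real plane to the complex numbers. -/
noncomputable def zt (p : ℝ × ℝ) : ℂ := (p.1 : ℂ) + (p.2 : ℂ) * Complex.I

lemma zt_cont : Continuous zt := by unfold zt; fun_prop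

lemma zt_inj : Function.Injective zt := by
  intro p q h
  have h1 := congrArg Complex.re h
  have h2 := congrArg Complex.im h
  simp [zt] at h1 h2
  exact Prod.ext h1 h2

lemma zt_sub_ne {a z : ℝ × ℝ} (h : z ≠ a) : zt z - zt a ≠ 0 :=
  sub_ne_zero.mpr (fun h' => h (zt_inj h'))

/-- `f` has a continuous logarithm on `K`. -/
def HasLog (K : Set (ℝ × ℝ)) (f : ℝ × ℝ → ℂ) : Prop :=
  ∃ g : ℝ × ℝ → ℂ, ContinuousOn g K ∧ ∀ z ∈ K, Complex.exp (g z) = f z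

lemma HasLog.mono {K K' : Set (ℝ × ℝ)} {f} (h : HasLog K f) (hK : K' ⊆ K) : HasLog K' f := by
  obtain ⟨g, h1, h2⟩ := h
  exact ⟨g, h1.mono hK, fun z hz => h2 z (hK hz)⟩

/-- Two continuous logarithms on a preconnected set differ by a constant. -/
lemma log_const {X : Type*} [TopologicalSpace X] {S : Set X} (hS : IsPreconnected S)
    {g₁ g₂ : X → ℂ} (h1 : ContinuousOn g₁ S) (h2 : ContinuousOn g₂ S)
    (h : ∀ z ∈ S, Complex.exp (g₁ z) = Complex.exp (g₂ z)) {x y : X} (hx : x ∈ S) (hy : y ∈ S) :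
    g₁ x - g₂ x = g₁ y - g₂ y := by
  have hdisc : IsDiscrete (Set.range (fun n : ℤ => (n : ℝ))) := by
    rw [isDiscrete_iff_discreteTopology]
    exact (Int.isClosedEmbedding_coe_real.isEmbedding.toHomeomorph.symm.isEmbedding).discreteTopology
  have hperiod : ∀ z ∈ S, ∃ n : ℤ, g₁ z - g₂ z = n * (2 * Real.pi * Complex.I) := by
    intro z hz
    obtain ⟨n, hn⟩ := Complex.exp_eq_exp_iff_exists_int.mp (h z hz)
    exact ⟨n, by rw [hn]; ring⟩
  have hc : ContinuousOn (fun z => ((g₁ z - g₂ z) / (2 * Real.pi * Complex.I)).re) S :=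
    Complex.continuous_re.comp_continuousOn ((h1.sub h2).div_const _)
  have hpi : (2 * Real.pi * Complex.I : ℂ) ≠ 0 := Complex.two_pi_I_ne_zero
  have hm : MapsTo (fun z => ((g₁ z - g₂ z) / (2 * Real.pi * Complex.I)).re) S
      (Set.range (fun n : ℤ => (n : ℝ))) := by
    intro z hz
    obtain ⟨n, hn⟩ := hperiod z hz
    refine ⟨n, ?_⟩
    simp only [hn]
    rw [mul_div_assoc, div_self hpi]; simp
  have key := hS.constant_of_mapsTo hdisc hc hm hx hy
  obtain ⟨n, hn⟩ := hperiod x hx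
  obtain ⟨m, hm⟩ := hperiod y hy
  simp only [hn, hm] at key ⊢
  rw [mul_div_assoc, div_self hpi, mul_div_assoc, div_self hpi] at key
  simp at key
  rw [key]

/-- A nonvanishing function on a simple arc has a logarithm. -/
lemma hasLog_arc {u v : ℝ × ℝ} (p : Path u v) (hp : Function.Injective p) {f : ℝ × ℝ → ℂ}
    (hf : ContinuousOn f (range p)) (hne : ∀ z ∈ range p, f z ≠ 0) : HasLog (range p) f := by
  have hce : IsClosedEmbedding p := p.continuous.isClosedEmbedding hp
  let q : C(ℝ, ℂ) := ⟨fun t => f (p (projIcc 0 1 zero_le_one t)), by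
    apply hf.comp_continuous (p.continuous.comp continuous_projIcc)
    intro x; exact mem_range_self _⟩
  have hq0 : q 0 ≠ 0 := hne _ (mem_range_self _)
  obtain ⟨F, ⟨-, hF⟩, -⟩ := Complex.isCoveringMapOn_exp.existsUnique_continuousMap_lifts q
    (Complex.exp_log hq0) (fun x => hne _ (mem_range_self _))
  let φ := hce.isEmbedding.toHomeomorph
  refine ⟨fun z => F ((Function.invFun p z : unitInterval) : ℝ), ?_, ?_⟩
  · rw [continuousOn_iff_continuous_domRestrict]
    have : (range p).domRestrict (fun z => F ((Function.invFun p z : unitInterval) : ℝ)) =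
        fun z => F ((φ.symm z : unitInterval) : ℝ) := by
      ext ⟨z, t, rfl⟩
      have h1 : φ.symm ⟨p t, mem_range_self t⟩ = t := by
        rw [Homeomorph.symm_apply_eq]; rfl
      rw [h1]
      simp [Set.domRestrict, Function.leftInverse_invFun hp t]
    rw [this]
    fun_prop
  · rintro z ⟨t, rfl⟩
    have := congrFun hF (t : ℝ)
    simp only [Function.comp_apply] at this
    simp only [Function.leftInverse_invFun hp t, this]
    simp [q]

/-- Gluing. -/
lemma glue {K₁ K₂ : Set (ℝ × ℝ)} (h1 : IsClosed K₁) (h2 : IsClosed K₂) {f : ℝ × ℝ → ℂ}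
    {g₁ g₂ : ℝ × ℝ → ℂ} (c1 : ContinuousOn g₁ K₁) (c2 : ContinuousOn g₂ K₂)
    (e1 : ∀ z ∈ K₁, Complex.exp (g₁ z) = f z) (e2 : ∀ z ∈ K₂, Complex.exp (g₂ z) = f z)
    (hag : ∀ z ∈ K₁, z ∈ K₂ → g₁ z = g₂ z) : HasLog (K₁ ∪ K₂) f := by
  classical
  have a1 : ∀ z ∈ K₁, K₁.piecewise g₁ g₂ z = g₁ z := fun z hz => by simp [hz]
  have a2 : ∀ z ∈ K₂, K₁.piecewise g₁ g₂ z = g₂ z := fun z hz => by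
    by_cases h : z ∈ K₁
    · rw [a1 z h, hag z h hz]
    · simp [h]
  refine ⟨K₁.piecewise g₁ g₂, ?_, ?_⟩
  · exact ContinuousOn.union_of_isClosed (c1.congr a1) (c2.congr a2) h1 h2
  · rintro z (hz | hz)
    · rw [a1 z hz, e1 z hz]
    · rw [a2 z hz, e2 z hz]

/-- Gluing along at most one point. -/
lemma glue_point {K₁ K₂ : Set (ℝ × ℝ)} (h1 : IsClosed K₁) (h2 : IsClosed K₂) {f : ℝ × ℝ → ℂ}
    (l1 : HasLog K₁ f) (l2 : HasLog K₂ f) (x : ℝ × ℝ) (hx1 : x ∈ K₁) (hx2 : x ∈ K₂)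
    (hx : ∀ z ∈ K₁, z ∈ K₂ → z = x) : HasLog (K₁ ∪ K₂) f := by
  obtain ⟨g₁, c1, e1⟩ := l1
  obtain ⟨g₂, c2, e2⟩ := l2
  refine glue (g₁ := g₁) (g₂ := fun z => g₂ z + (g₁ x - g₂ x)) h1 h2 c1
    (c2.add continuousOn_const) e1 ?_ ?_
  · intro z hz
    rw [Complex.exp_add, Complex.exp_sub, e1 x hx1, e2 x hx2, div_self, mul_one, e2 z hz]
    rw [← e1 x hx1]; exact Complex.exp_ne_zero _
  · intro z hz1 hz2
    rw [hx z hz1 hz2]; ring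

/-- The easy half of Eilenberg's criterion. -/
lemma hasLog_of_joined {K S : Set (ℝ × ℝ)} (hK : IsCompact K) (hS : IsPreconnected S)
    (hd : ∀ z ∈ S, z ∉ K) {a b : ℝ × ℝ} (ha : a ∈ S) (hb : b ∈ S) :
    HasLog K (fun z => (zt z - zt a) / (zt z - zt b)) := by
  refine hS.induction₂ (fun a b => HasLog K (fun z => (zt z - zt a) / (zt z - zt b)))
    ?_ ?_ ?_ ha hb
  · intro x hx
    have hKc : IsClosed (zt '' K) := (hK.image zt_cont).isClosed
    have hxK : zt x ∉ zt '' K := by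
      rintro ⟨y, hy, hyx⟩
      exact hd x hx (zt_inj hyx ▸ hy)
    obtain ⟨ε, hε, hball⟩ := Metric.isOpen_iff.mp hKc.isOpen_compl _ hxK
    have hev : ∀ᶠ y in 𝓝[S] x, dist (zt y) (zt x) < ε / 2 :=
      nhdsWithin_le_nhds (zt_cont.continuousAt.eventually (Metric.ball_mem_nhds _ (half_pos hε)))
    filter_upwards [hev, self_mem_nhdsWithin] with y hy hyS
    have hfar : ∀ z ∈ K, ε ≤ ‖zt z - zt x‖ := by
      intro z hz
      by_contra hlt
      push Not at hlt
      exact hball (by rw [Metric.mem_ball, dist_eq_norm]; exact hlt) ⟨z, hz, rfl⟩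
    have hne : ∀ z ∈ K, zt z - zt y ≠ 0 := fun z hz => zt_sub_ne (fun h => hd y hyS (h ▸ hz))
    have hslit : ∀ z ∈ K, (zt z - zt x) / (zt z - zt y) ∈ Complex.slitPlane := by
      intro z hz
      have h1 : ‖zt y - zt x‖ < ε / 2 := by rwa [dist_eq_norm] at hy
      have h2 := hfar z hz
      have h3 : ε / 2 < ‖zt z - zt y‖ := by
        have : ‖zt z - zt x‖ ≤ ‖zt z - zt y‖ + ‖zt y - zt x‖ := norm_sub_le_norm_sub_add_norm_sub _ _ _
        linarith
      have h4 : (zt z - zt x) / (zt z - zt y) = 1 + (zt y - zt x) / (zt z - zt y) := by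
        field_simp [hne z hz]; ring
      rw [h4]
      apply Complex.mem_slitPlane_of_norm_lt_one
      rw [norm_div, div_lt_one (by linarith)]
      linarith
    refine ⟨fun z => Complex.log ((zt z - zt x) / (zt z - zt y)), ?_, ?_⟩
    · apply ContinuousOn.clog
      · exact (zt_cont.sub continuous_const).continuousOn.div
          (zt_cont.sub continuous_const).continuousOn hne
      · exact hslit
    · intro z hz
      exact Complex.exp_log (Complex.slitPlane_ne_zero (hslit z hz))
  · rintro x y z hx hy hz ⟨g, c, e⟩ ⟨g', c', e'⟩
    refine ⟨fun w => g w + g' w, c.add c', fun w hw => ?_⟩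
    rw [Complex.exp_add, e w hw, e' w hw]
    have := zt_sub_ne (a := y) (z := w) (fun h => hd y hy (h ▸ hw))
    have := zt_sub_ne (a := z) (z := w) (fun h => hd z hz (h ▸ hw))
    field_simp
  · rintro x y hx hy ⟨g, c, e⟩
    refine ⟨fun w => - g w, c.neg, fun w hw => ?_⟩
    rw [Complex.exp_neg, e w hw, inv_div]

/-- The hard half of Eilenberg's criterion. -/
lemma winding_zero {K O : Set (ℝ × ℝ)} (hK : IsClosed K) (hO : IsOpen O)
    (hb : Bornology.IsBounded O) (hfr : frontier O ⊆ K) {a : ℝ × ℝ} (ha : a ∈ O) (k : ℤ)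
    {h : ℝ × ℝ → ℂ} (hc : ContinuousOn h (closure O)) (hne : ∀ z ∈ closure O, h z ≠ 0)
    (hl : HasLog K (fun z => (zt z - zt a) ^ k * h z)) : k = 0 := by
  classical
  obtain ⟨g, cg, eg⟩ := hl
  obtain ⟨G, hG⟩ := ContinuousMap.exists_restrict_eq hK
    (⟨K.domRestrict g, continuousOn_iff_continuous_domRestrict.mp cg⟩ : C(K, ℂ))
  have hGK : ∀ z ∈ K, G z = g z := fun z hz => congrArg (fun F : C(K, ℂ) => F ⟨z, hz⟩) hG
  let Φ : ℝ × ℝ → ℂ := O.piecewise (fun z => Complex.exp (G z) / h z) (fun z => (zt z - zt a) ^ k)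
  have hOc : closure Oᶜ = Oᶜ := hO.isClosed_compl.closure_eq
  have hane : ∀ z ∈ Oᶜ, zt z - zt a ≠ 0 := fun z hz => zt_sub_ne (fun h => hz (h ▸ ha))
  have hΦc : Continuous Φ := by
    apply continuous_piecewise
    · intro z hz
      have hzK := hfr hz
      rw [hGK z hzK, eg z hzK, mul_div_assoc, div_self (hne z (frontier_subset_closure hz)), mul_one]
    · exact (Complex.continuous_exp.comp G.continuous).continuousOn.div hc hne
    · rw [hOc]
      exact ContinuousOn.zpow₀ (zt_cont.sub continuous_const).continuousOn k
        (fun z hz => Or.inl (hane z hz))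
  have hΦne : ∀ z, Φ z ≠ 0 := by
    intro z
    by_cases hz : z ∈ O
    · simp only [Φ, piecewise_eq_of_mem _ _ _ hz]
      exact div_ne_zero (Complex.exp_ne_zero _) (hne z (subset_closure hz))
    · simp only [Φ, piecewise_eq_of_notMem _ _ _ hz]
      exact zpow_ne_zero _ (hane z hz)
  obtain ⟨L, ⟨-, hL⟩, -⟩ := Complex.isCoveringMapOn_exp.existsUnique_continuousMap_lifts
    (⟨Φ, hΦc⟩ : C(ℝ × ℝ, ℂ)) (a₀ := (0 : ℝ × ℝ)) (Complex.exp_log (hΦne 0)) hΦne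
  have hL' : ∀ z, Complex.exp (L z) = Φ z := fun z => congrFun hL z
  obtain ⟨R, hR0, hR⟩ : ∃ R : ℝ, 0 < R ∧ ∀ z ∈ O, ‖zt z - zt a‖ < R := by
    obtain ⟨M, hM⟩ := (hb.isCompact_closure.image_of_continuousOn
      (zt_cont.sub (continuous_const (y := zt a))).norm.continuousOn).isBounded.bddAbove
    refine ⟨max M 0 + 1, by positivity, fun z hz => ?_⟩
    have : ‖zt z - zt a‖ ≤ M := hM ⟨z, subset_closure hz, rfl⟩
    have := le_max_left M 0
    linarith
  let c : ℝ → ℝ × ℝ := fun t => (a.1 + R * Real.cos t, a.2 + R * Real.sin t)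
  have hcc : Continuous c := by fun_prop
  have hcz : ∀ t, zt (c t) - zt a = Complex.exp (Real.log R + t * Complex.I) := by
    intro t
    rw [Complex.exp_add, Complex.exp_mul_I, ← Complex.ofReal_exp, Real.exp_log hR0]
    simp [zt, c]
    ring
  have hcO : ∀ t, c t ∉ O := by
    intro t ht
    have := hR _ ht
    rw [hcz, Complex.norm_exp] at this
    simp [Real.exp_log hR0] at this
  have hexp : ∀ t ∈ (univ : Set ℝ), Complex.exp (L (c t)) =
      Complex.exp (k * (Real.log R + t * Complex.I)) := by
    intro t _
    rw [hL', Complex.exp_int_mul, ← hcz]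
    simp only [Φ, piecewise_eq_of_notMem _ _ _ (hcO t)]
  have key := log_const isPreconnected_univ (g₁ := fun t : ℝ => L (c t))
    (g₂ := fun t : ℝ => (k : ℂ) * (Real.log R + t * Complex.I))
    (L.continuous.comp hcc).continuousOn (by fun_prop) hexp (mem_univ 0) (mem_univ (2 * Real.pi))
  have hcp : c (2 * Real.pi) = c 0 := by simp [c]
  simp only [hcp] at key
  have h2 : (k : ℂ) * (2 * Real.pi * Complex.I) = 0 := by
    push_cast at key
    linear_combination key
  rcases mul_eq_zero.mp h2 with h3 | h3
  · exact_mod_cast h3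
  · exact absurd h3 Complex.two_pi_I_ne_zero

/-- Of two disjoint open sets with frontier in a compact set, one is bounded. -/
lemma bounded_or {K O O' : Set (ℝ × ℝ)} (hK : IsCompact K) (hO : IsOpen O) (hO' : IsOpen O')
    (hd : Disjoint O O') (hfr : frontier O ⊆ K) :
    Bornology.IsBounded O ∨ Bornology.IsBounded O' := by
  obtain ⟨M, hM⟩ := (hK.image zt_cont.norm).isBounded.bddAbove
  let R := max M 0 + 1
  have hR : 0 < R := by positivity
  let T : Set (ℝ × ℝ) := (fun p : ℝ × ℝ => (p.1 * Real.cos p.2, p.1 * Real.sin p.2)) '' (Ioi R ×ˢ univ)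
  have hT : IsPreconnected T := by
    apply IsPreconnected.image
    · exact isPreconnected_Ioi.prod isPreconnected_univ
    · fun_prop
  have hTmem : ∀ z, R < ‖zt z‖ → z ∈ T := by
    intro z hz
    refine ⟨(‖zt z‖, Complex.arg (zt z)), ⟨hz, mem_univ _⟩, ?_⟩
    have := Complex.norm_mul_cos_arg (zt z)
    have h2 := Complex.norm_mul_sin_arg (zt z)
    simp only [this, h2]
    simp [zt]
  have hbd : ∀ A : Set (ℝ × ℝ), (∀ z ∈ A, ‖zt z‖ ≤ R) → Bornology.IsBounded A := by
    intro A hA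
    refine (Metric.isBounded_closedBall (x := (0 : ℝ × ℝ)) (r := R)).subset ?_
    intro z hz
    rw [mem_closedBall_zero_iff, Prod.norm_def]
    have h1 := Complex.abs_re_le_norm (zt z)
    have h2 := Complex.abs_im_le_norm (zt z)
    have := hA z hz
    simp [zt] at h1 h2
    simp only [zt] at this
    exact max_le (by rw [Real.norm_eq_abs]; linarith) (by rw [Real.norm_eq_abs]; linarith)
  have hTK : ∀ z ∈ T, z ∉ K := by
    rintro z ⟨⟨r, t⟩, ⟨hr, -⟩, rfl⟩ hzK
    have h1 : ‖zt (r * Real.cos t, r * Real.sin t)‖ ≤ M := hM ⟨_, hzK, rfl⟩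
    have hr : R < r := hr
    have h2 : zt (r * Real.cos t, r * Real.sin t) = r * Complex.exp (t * Complex.I) := by
      rw [Complex.exp_mul_I]; simp [zt]; ring
    rw [h2, norm_mul, Complex.norm_exp_ofReal_mul_I, mul_one, Complex.norm_real, Real.norm_eq_abs] at h1
    have := le_abs_self r
    have := le_max_left M 0
    have : R = max M 0 + 1 := rfl
    linarith
  by_cases hTO : (T ∩ O).Nonempty
  · right
    have hsub : T ⊆ O := by
      apply hT.subset_left_of_subset_union hO (isClosed_closure (s := O)).isOpen_compl
      · exact disjoint_compl_right.mono_left subset_closure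
      · intro z hz
        by_cases hzO : z ∈ O
        · exact Or.inl hzO
        · right
          intro hzc
          exact hTK z hz (hfr ⟨hzc, by rwa [hO.interior_eq]⟩)
      · exact hTO
    apply hbd
    intro z hz
    by_contra hlt
    push Not at hlt
    exact hd.le_bot ⟨hsub (hTmem z hlt), hz⟩
  · left
    apply hbd
    intro z hz
    by_contra hlt
    push Not at hlt
    exact hTO ⟨z, hTmem z hlt, hz⟩

/-- A pair of separated points gives a map without logarithm. -/
lemma no_log_of_separated {K O : Set (ℝ × ℝ)} (hK : IsCompact K) (hO : IsOpen O)
    (hfr : frontier O ⊆ K) {a b : ℝ × ℝ} (ha : a ∈ O) (hb : b ∉ O) (hbK : b ∉ K) :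
    ¬ HasLog K (fun z => (zt z - zt a) / (zt z - zt b)) := by
  intro hl
  have hcl : closure O ⊆ O ∪ K := by
    rw [closure_eq_self_union_frontier]; exact union_subset_union_right _ hfr
  have hbc : b ∉ closure O := fun h => (hcl h).elim hb hbK
  have hO' : IsOpen (closure O)ᶜ := isClosed_closure.isOpen_compl
  rcases bounded_or hK hO hO' (disjoint_compl_right.mono_left subset_closure) hfr with h | h
  · have := winding_zero hK.isClosed hO h hfr ha 1 (h := fun z => (zt z - zt b)⁻¹) ?_ ?_ ?_
    · omega
    · apply ContinuousOn.inv₀ (zt_cont.sub continuous_const).continuousOn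
      intro z hz
      exact zt_sub_ne (fun h => hbc (h ▸ hz))
    · intro z hz
      exact inv_ne_zero (zt_sub_ne (fun h => hbc (h ▸ hz)))
    · simpa [div_eq_mul_inv] using hl
  · have hclc : closure ((closure O)ᶜ) ⊆ Oᶜ :=
      closure_minimal (compl_subset_compl.mpr subset_closure) hO.isClosed_compl
    have := winding_zero (a := b) hK.isClosed hO' h ?_ hbc (-1) (h := fun z => (zt z - zt a)) ?_ ?_ ?_
    · omega
    · intro z hz
      have h1 : z ∉ O := hclc hz.1
      have h2 : z ∈ closure O := by
        have := hz.2
        rw [hO'.interior_eq] at this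
        simpa using this
      exact (hcl h2).resolve_left h1
    · exact (zt_cont.sub continuous_const).continuousOn
    · intro z hz
      exact zt_sub_ne (fun h => hclc hz (h ▸ ha))
    · simpa [div_eq_mul_inv, mul_comm] using hl

end QPO

namespace QPO
open Set Topology Filter

section Drawing
variable {V : Type*} [Fintype V] {G : SimpleGraph V} (D : PlaneDrawing G)

/-- The arc of an (unordered) edge. -/
def arcset (e : Sym2 V) : Set (ℝ × ℝ) :=
  {z | ∃ (u v : V) (h : G.Adj u v), s(u, v) = e ∧ z ∈ range (D.arc h)}

lemma arcset_eq {u v : V} (h : G.Adj u v) : arcset D s(u, v) = range (D.arc h) := by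
  ext z
  constructor
  · rintro ⟨u', v', h', he, hz⟩
    rcases Sym2.eq_iff.mp he with ⟨rfl, rfl⟩ | ⟨rfl, rfl⟩
    · exact hz
    · rw [← D.arc_symm h]; exact hz
  · intro hz
    exact ⟨u, v, h, rfl, hz⟩

lemma arcset_compact {e : Sym2 V} (he : e ∈ G.edgeSet) : IsCompact (arcset D e) := by
  induction e with | _ u v =>
  rw [arcset_eq D (G.mem_edgeSet.mp he)]
  exact isCompact_range (D.arc _).continuous

lemma arcset_preconn {e : Sym2 V} (he : e ∈ G.edgeSet) : IsPreconnected (arcset D e) := by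
  induction e with | _ u v =>
  rw [arcset_eq D (G.mem_edgeSet.mp he)]
  exact isPreconnected_range (D.arc _).continuous

lemma left_mem_arcset {u v : V} (h : G.Adj u v) : D.vert u ∈ arcset D s(u, v) := by
  rw [arcset_eq D h]; exact ⟨0, (D.arc h).source⟩

lemma right_mem_arcset {u v : V} (h : G.Adj u v) : D.vert v ∈ arcset D s(u, v) := by
  rw [arcset_eq D h]; exact ⟨1, (D.arc h).target⟩

lemma arcset_log {e : Sym2 V} (he : e ∈ G.edgeSet) {f : ℝ × ℝ → ℂ}
    (hf : ContinuousOn f (arcset D e)) (hne : ∀ z ∈ arcset D e, f z ≠ 0) :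
    HasLog (arcset D e) f := by
  induction e with | _ u v =>
  rw [arcset_eq D (G.mem_edgeSet.mp he)] at *
  exact hasLog_arc _ (D.arc_inj _) hf hne

lemma range_inter {u v u' v' : V} (h : G.Adj u v) (h' : G.Adj u' v') (hne : s(u, v) ≠ s(u', v'))
    {z : ℝ × ℝ} (hz : z ∈ range (D.arc h)) (hz' : z ∈ range (D.arc h')) :
    ∃ w, z = D.vert w ∧ (w = u ∨ w = v) ∧ (w = u' ∨ w = v') := by
  have := D.arc_disjoint h h' hne ⟨hz, hz'⟩
  obtain ⟨h1, h2⟩ := this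
  rcases h1 with h1 | h1
  · refine ⟨u, h1, Or.inl rfl, ?_⟩
    rw [h1] at h2
    exact h2.imp (fun h => D.vert_inj h) (fun h => D.vert_inj h)
  · refine ⟨v, h1, Or.inr rfl, ?_⟩
    rw [h1] at h2
    exact h2.imp (fun h => D.vert_inj h) (fun h => D.vert_inj h)

/-- The drawing with the open arc of `e` removed. -/
def Kminus (e : Sym2 V) : Set (ℝ × ℝ) :=
  range D.vert ∪ ⋃ e' ∈ {e' : Sym2 V | e' ∈ G.edgeSet ∧ e' ≠ e}, arcset D e'

lemma image_eq : D.image = range D.vert ∪ ⋃ e ∈ G.edgeSet, arcset D e := by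
  unfold PlaneDrawing.image
  congr 1
  ext z
  simp only [mem_iUnion]
  constructor
  · rintro ⟨u, v, h, hz⟩
    exact ⟨s(u, v), G.mem_edgeSet.mpr h, u, v, h, rfl, hz⟩
  · rintro ⟨e, he, u, v, h, rfl, hz⟩
    exact ⟨u, v, h, hz⟩

lemma Kminus_compact (e : Sym2 V) : IsCompact (Kminus D e) := by
  refine (Set.finite_range D.vert).isCompact.union ?_
  apply Set.Finite.isCompact_biUnion (Set.toFinite _)
  intro e' he'
  exact arcset_compact D he'.1

lemma image_compact : IsCompact D.image := by
  rw [image_eq]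
  refine (Set.finite_range D.vert).isCompact.union ?_
  apply Set.Finite.isCompact_biUnion (Set.toFinite _)
  intro e' he'
  exact arcset_compact D he'

lemma image_split {e : Sym2 V} (he : e ∈ G.edgeSet) : D.image = Kminus D e ∪ arcset D e := by
  rw [image_eq, Kminus]
  ext z
  simp only [mem_union, mem_iUnion]
  constructor
  · rintro (h | ⟨e', he', hz⟩)
    · exact Or.inl (Or.inl h)
    · by_cases h : e' = e
      · exact Or.inr (h ▸ hz)
      · exact Or.inl (Or.inr ⟨e', ⟨he', h⟩, hz⟩)
  · rintro ((h | ⟨e', he', hz⟩) | h)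
    · exact Or.inl h
    · exact Or.inr ⟨e', he'.1, hz⟩
    · exact Or.inr ⟨e, he, h⟩

lemma arcset_sub_image {e : Sym2 V} (he : e ∈ G.edgeSet) : arcset D e ⊆ D.image := by
  rw [image_split D he]; exact subset_union_right

lemma arcset_sub_Kminus {e e' : Sym2 V} (he : e ∈ G.edgeSet) (hne : e ≠ e') :
    arcset D e ⊆ Kminus D e' := by
  intro z hz
  right
  exact mem_biUnion (show e ∈ {e'' : Sym2 V | e'' ∈ G.edgeSet ∧ e'' ≠ e'} from ⟨he, hne⟩) hz

lemma Kminus_inter {u v : V} (h : G.Adj u v) {z : ℝ × ℝ} (h1 : z ∈ Kminus D s(u, v))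
    (h2 : z ∈ arcset D s(u, v)) : z = D.vert u ∨ z = D.vert v := by
  rw [arcset_eq D h] at h2
  rcases h1 with ⟨w, rfl⟩ | h1
  · rcases D.arc_vert h w h2 with rfl | rfl <;> simp
  · simp only [mem_iUnion] at h1
    obtain ⟨e', ⟨he', hne⟩, u', v', h', rfl, hz⟩ := h1
    obtain ⟨w, rfl, rfl | rfl, -⟩ := range_inter D h h' hne.symm h2 hz <;> simp

lemma mid_notMem {u v : V} (h : G.Adj u v) {t : unitInterval} (h0 : t ≠ 0) (h1 : t ≠ 1) :
    D.arc h t ∉ Kminus D s(u, v) := by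
  intro hK
  rcases Kminus_inter D h hK (by rw [arcset_eq D h]; exact mem_range_self _) with hz | hz
  · exact h0 (D.arc_inj h (hz.trans (D.arc h).source.symm))
  · exact h1 (D.arc_inj h (hz.trans (D.arc h).target.symm))

lemma exists_mid {e : Sym2 V} (he : e ∈ G.edgeSet) : ∃ x ∈ arcset D e, x ∉ Kminus D e := by
  induction e with | _ u v =>
  have h := G.mem_edgeSet.mp he
  have hh : (1 / 2 : ℝ) ∈ unitInterval := ⟨by norm_num, by norm_num⟩
  refine ⟨D.arc h ⟨1 / 2, hh⟩, by rw [arcset_eq D h]; exact mem_range_self _, mid_notMem D h ?_ ?_⟩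
  · intro hc; have := congrArg Subtype.val hc; norm_num at this
  · intro hc; have := congrArg Subtype.val hc; norm_num at this

/-- logarithms agreeing at the ends glue to the whole drawing. -/
lemma glue_ends {u v : V} (h : G.Adj u v) {f : ℝ × ℝ → ℂ} {g₁ g₂ : ℝ × ℝ → ℂ}
    (c1 : ContinuousOn g₁ (Kminus D s(u, v))) (c2 : ContinuousOn g₂ (arcset D s(u, v)))
    (e1 : ∀ z ∈ Kminus D s(u, v), Complex.exp (g₁ z) = f z)
    (e2 : ∀ z ∈ arcset D s(u, v), Complex.exp (g₂ z) = f z)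
    (hag : g₂ (D.vert v) - g₂ (D.vert u) = g₁ (D.vert v) - g₁ (D.vert u)) :
    HasLog D.image f := by
  have he : s(u, v) ∈ G.edgeSet := G.mem_edgeSet.mpr h
  rw [image_split D he]
  have hu1 : D.vert u ∈ Kminus D s(u, v) := Or.inl (mem_range_self _)
  have hu2 := left_mem_arcset D h
  refine glue (g₁ := g₁) (g₂ := fun z => g₂ z + (g₁ (D.vert u) - g₂ (D.vert u)))
    (Kminus_compact D _).isClosed (arcset_compact D he).isClosed c1 (c2.add continuousOn_const)
    e1 ?_ ?_
  · intro z hz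
    rw [Complex.exp_add, Complex.exp_sub, e1 _ hu1, e2 _ hu2, div_self, mul_one, e2 z hz]
    rw [← e1 _ hu1]; exact Complex.exp_ne_zero _
  · intro z hz1 hz2
    rcases Kminus_inter D h hz1 hz2 with rfl | rfl
    · ring
    · linear_combination -hag

/-- A simple arc has empty interior. -/
lemma interior_arc {u v : ℝ × ℝ} (p : Path u v) (hp : Function.Injective p) :
    interior (range p) = ∅ := by
  by_contra hne
  obtain ⟨x, hx⟩ := nonempty_iff_ne_empty.mpr hne
  obtain ⟨ε, hε, hball⟩ := Metric.isOpen_iff.mp isOpen_interior x hx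
  have hsub : Metric.ball x ε ⊆ range p := hball.trans interior_subset
  have hce : IsClosedEmbedding p := p.continuous.isClosedEmbedding hp
  have hrank : 1 < Module.rank ℝ (ℝ × ℝ) := by
    rw [rank_prod']; simp; norm_num
  -- preimage of connected subsets are connected
  have hpre : ∀ S ⊆ range p, IsPreconnected S → IsPreconnected (p ⁻¹' S) := by
    intro S hS hSc
    rw [← hce.isInducing.isPreconnected_image, image_preimage_eq_of_subset hS]
    exact hSc
  have hB := hpre _ hsub (convex_ball x ε).isPreconnected
  -- three distinct points of the ball
  have hnt : ∃ t₁ t₂ t₃ : unitInterval, t₁ < t₂ ∧ t₂ < t₃ ∧ p t₁ ∈ Metric.ball x ε ∧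
      p t₂ ∈ Metric.ball x ε ∧ p t₃ ∈ Metric.ball x ε := by
    obtain ⟨t, ht⟩ := hsub (Metric.mem_ball_self hε)
    let y : ℝ × ℝ := (x.1 + ε / 2, x.2)
    have hy : y ∈ Metric.ball x ε := by
      simp [y, Prod.dist_eq, Real.dist_eq, abs_of_pos, hε]
    obtain ⟨t', ht'⟩ := hsub hy
    have hne : t ≠ t' := by
      rintro rfl
      rw [ht] at ht'
      have := congrArg Prod.fst ht'
      simp [y] at this
      linarith
    have hoc := hB.ordConnected
    have hmem : t ∈ p ⁻¹' Metric.ball x ε := by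
      simp only [mem_preimage, ht]; exact Metric.mem_ball_self hε
    have hmem' : t' ∈ p ⁻¹' Metric.ball x ε := by
      simp only [mem_preimage, ht']; exact hy
    rcases lt_or_gt_of_ne hne with hlt | hlt
    · obtain ⟨s, hs1, hs2⟩ := exists_between hlt
      exact ⟨t, s, t', hs1, hs2, hmem, hoc.out hmem hmem' ⟨hs1.le, hs2.le⟩, hmem'⟩
    · obtain ⟨s, hs1, hs2⟩ := exists_between hlt
      exact ⟨t', s, t, hs1, hs2, hmem', hoc.out hmem' hmem ⟨hs1.le, hs2.le⟩, hmem⟩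
  obtain ⟨t₁, t₂, t₃, h12, h23, m1, m2, m3⟩ := hnt
  obtain ⟨δ, hδ, hδb⟩ := Metric.isOpen_iff.mp Metric.isOpen_ball (p t₂) m2
  have hconn : IsPreconnected (Metric.ball (p t₂) δ \ {p t₂}) := by
    have h2 : Metric.ball (p t₂) δ \ {p t₂} =
        (fun q : ℝ × (ℝ × ℝ) => p t₂ + q.1 • q.2) '' (Ioo 0 δ ×ˢ Metric.sphere (0 : ℝ × ℝ) 1) := by
      ext z
      constructor
      · rintro ⟨hz, hzne⟩
        have hn : 0 < ‖z - p t₂‖ := norm_pos_iff.mpr (sub_ne_zero.mpr hzne)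
        refine ⟨(‖z - p t₂‖, ‖z - p t₂‖⁻¹ • (z - p t₂)), ⟨⟨hn, ?_⟩, ?_⟩, ?_⟩
        · simpa [dist_eq_norm] using hz
        · simp only [mem_sphere_zero_iff_norm, norm_smul, norm_inv, norm_norm]
          exact inv_mul_cancel₀ hn.ne'
        · simp only [smul_smul, mul_inv_cancel₀ hn.ne', one_smul]
          abel
      · rintro ⟨⟨r, s⟩, ⟨⟨hr1, hr2⟩, hs⟩, rfl⟩
        have hs1 : ‖s‖ = 1 := by simpa using hs
        have hr1 : 0 < r := hr1
        have hr2 : r < δ := hr2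
        constructor
        · simp only [Metric.mem_ball, dist_eq_norm, add_sub_cancel_left, norm_smul, hs1, mul_one]
          simpa [abs_of_pos hr1] using hr2
        · intro h
          have : r • s = 0 := by simpa using h
          rcases smul_eq_zero.mp this with h | h
          · linarith
          · rw [h] at hs1; simp at hs1
    rw [h2]
    refine (isPreconnected_Ioo.prod (isPreconnected_sphere hrank 0 1)).image _ ?_
    fun_prop
  have hP := hpre _ (Set.sdiff_subset.trans (hδb.trans hsub)) hconn
  have hoc := hP.ordConnected
  have hnb : p ⁻¹' Metric.ball (p t₂) δ ∈ 𝓝 t₂ :=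
    p.continuous.continuousAt.preimage_mem_nhds (Metric.ball_mem_nhds _ hδ)
  obtain ⟨l, ⟨-, hl⟩, hlI⟩ := exists_Ioc_subset_of_mem_nhds' hnb h12
  obtain ⟨r, ⟨hr, -⟩, hrI⟩ := exists_Ico_subset_of_mem_nhds' hnb h23
  obtain ⟨l', hl1, hl2⟩ := exists_between hl
  obtain ⟨r', hr1, hr2⟩ := exists_between hr
  have := hoc.out (show l' ∈ p ⁻¹' (Metric.ball (p t₂) δ \ {p t₂}) from
      ⟨hlI ⟨hl1, hl2.le⟩, fun h => hl2.ne (hp h)⟩)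
    (show r' ∈ p ⁻¹' (Metric.ball (p t₂) δ \ {p t₂}) from
      ⟨hrI ⟨hr1.le, hr2⟩, fun h => hr1.ne' (hp h)⟩)
    ⟨hl2.le, hr1.le⟩
  exact this.2 rfl

/-- The drawing has dense complement (also after adding anything). -/
lemma interior_image : interior D.image = ∅ := by
  rw [image_eq]
  have hF : (G.edgeSet).Finite := Set.toFinite _
  have key : ∀ S : Set (Sym2 V), S.Finite → S ⊆ G.edgeSet →
      interior (range D.vert ∪ ⋃ e ∈ S, arcset D e) = ∅ := by
    intro S hS
    refine Set.Finite.induction_on S hS ?_ ?_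
    · intro _
      simp only [mem_empty_iff_false, iUnion_of_empty, iUnion_empty, union_empty]
      have hc : (range D.vert).Countable := (Set.finite_range D.vert).countable
      rw [interior_eq_empty_iff_dense_compl]
      exact hc.dense_compl ℝ
    · intro e S he hSf ih hsub
      rw [biUnion_insert, union_left_comm, interior_union_isClosed_of_interior_empty]
      · have hee : e ∈ G.edgeSet := hsub (mem_insert _ _)
        clear ih hsub he
        induction e with | _ u v =>
        rw [arcset_eq D (G.mem_edgeSet.mp hee)]
        exact interior_arc _ (D.arc_inj _)
      · exact (arcset_compact D (hsub (mem_insert _ _))).isClosed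
      · exact ih (fun x hx => hsub (mem_insert_of_mem _ hx))
  exact key _ hF subset_rfl

end Drawing
end QPO

set_option linter.unusedSectionVars false
namespace QPO
open Set Topology Filter

section Faces
variable {V : Type*} [Fintype V] {G : SimpleGraph V} (D : PlaneDrawing G)

/-- Faces of a drawing. -/
def IsFace (U : Set (ℝ × ℝ)) : Prop := ∃ x ∉ D.image, connectedComponentIn D.imageᶜ x = U

/-- The edge `e` lies on the boundary of `U`. -/
def onBd (U : Set (ℝ × ℝ)) (e : Sym2 V) : Prop := e ∈ G.edgeSet ∧ arcset D e ⊆ frontier U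

/-- Every face is bounded by a four-cycle. -/
def Quad : Prop := ∀ x ∉ D.image,
    ∃ (a b c d : V) (hab : G.Adj a b) (hbc : G.Adj b c) (hcd : G.Adj c d)
      (hda : G.Adj d a), a ≠ c ∧ b ≠ d ∧
      frontier (connectedComponentIn D.imageᶜ x) =
        Set.range ⇑(D.arc hab) ∪ Set.range ⇑(D.arc hbc) ∪
          Set.range ⇑(D.arc hcd) ∪ Set.range ⇑(D.arc hda)

variable {D}

lemma image_compl_open : IsOpen D.imageᶜ := (image_compact D).isClosed.isOpen_compl

lemma IsFace.open {U : Set (ℝ × ℝ)} (hU : IsFace D U) : IsOpen U := by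
  obtain ⟨x, hx, rfl⟩ := hU
  exact image_compl_open.connectedComponentIn

lemma IsFace.preconn {U : Set (ℝ × ℝ)} (hU : IsFace D U) : IsPreconnected U := by
  obtain ⟨x, hx, rfl⟩ := hU
  exact isPreconnected_connectedComponentIn

lemma IsFace.nonempty {U : Set (ℝ × ℝ)} (hU : IsFace D U) : U.Nonempty := by
  obtain ⟨x, hx, rfl⟩ := hU
  exact ⟨x, mem_connectedComponentIn hx⟩

lemma IsFace.notMem {U : Set (ℝ × ℝ)} (hU : IsFace D U) {z} (hz : z ∈ U) : z ∉ D.image := by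
  obtain ⟨x, hx, rfl⟩ := hU
  exact connectedComponentIn_subset _ _ hz

lemma IsFace.eq_of_mem {U U' : Set (ℝ × ℝ)} (hU : IsFace D U) (hU' : IsFace D U') {z}
    (hz : z ∈ U) (hz' : z ∈ U') : U = U' := by
  obtain ⟨x, hx, rfl⟩ := hU
  obtain ⟨y, hy, rfl⟩ := hU'
  rw [connectedComponentIn_eq hz, connectedComponentIn_eq hz']

lemma IsFace.disj {U U' : Set (ℝ × ℝ)} (hU : IsFace D U) (hU' : IsFace D U') (hne : U ≠ U') :
    Disjoint U U' :=
  Set.disjoint_left.mpr fun _ h h' => hne (hU.eq_of_mem hU' h h')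

variable (D) in
lemma exists_face {x : ℝ × ℝ} (hx : x ∉ D.image) : ∃ U, IsFace D U ∧ x ∈ U :=
  ⟨_, ⟨x, hx, rfl⟩, mem_connectedComponentIn hx⟩

lemma IsFace.frontier_sub {U : Set (ℝ × ℝ)} (hU : IsFace D U) : frontier U ⊆ D.image := by
  intro z hz
  by_contra hzK
  obtain ⟨W, hW, hzW⟩ := exists_face D hzK
  rw [hU.open.frontier_eq] at hz
  obtain ⟨y, hy1, hy2⟩ := mem_closure_iff.mp hz.1 W hW.open hzW
  have := hU.eq_of_mem hW hy2 hy1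
  exact hz.2 (this ▸ hzW)

lemma IsFace.closure_sub {U : Set (ℝ × ℝ)} (hU : IsFace D U) : closure U ⊆ U ∪ D.image := by
  rw [closure_eq_self_union_frontier]; exact union_subset_union_right _ hU.frontier_sub

lemma face_cycle (hq : Quad D) {U : Set (ℝ × ℝ)} (hU : IsFace D U) :
    ∃ a b c d, G.Adj a b ∧ G.Adj b c ∧ G.Adj c d ∧ G.Adj d a ∧ a ≠ c ∧ b ≠ d ∧
      frontier U = arcset D s(a, b) ∪ arcset D s(b, c) ∪ arcset D s(c, d) ∪ arcset D s(d, a) := by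
  obtain ⟨x, hx, rfl⟩ := hU
  obtain ⟨a, b, c, d, hab, hbc, hcd, hda, h1, h2, h3⟩ := hq x hx
  refine ⟨a, b, c, d, hab, hbc, hcd, hda, h1, h2, ?_⟩
  rw [h3, arcset_eq D hab, arcset_eq D hbc, arcset_eq D hcd, arcset_eq D hda]

lemma mid_eq {e e' : Sym2 V} (he' : e' ∈ G.edgeSet) {x : ℝ × ℝ} (hx : x ∉ Kminus D e)
    (hx' : x ∈ arcset D e') : e' = e := by
  by_contra h
  exact hx (arcset_sub_Kminus D he' h hx')

lemma mid_frontier (hq : Quad D) {U : Set (ℝ × ℝ)} (hU : IsFace D U) {e : Sym2 V} {x : ℝ × ℝ}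
    (hx : x ∉ Kminus D e) (hxf : x ∈ frontier U) : onBd D U e := by
  obtain ⟨a, b, c, d, hab, hbc, hcd, hda, h1, h2, h3⟩ := face_cycle hq hU
  have key : ∀ e', e' ∈ G.edgeSet → arcset D e' ⊆ frontier U → x ∈ arcset D e' → onBd D U e := by
    intro e' he' hs hxe
    have := mid_eq he' hx hxe
    subst this
    exact ⟨he', hs⟩
  rw [h3] at hxf key
  rcases hxf with ((h | h) | h) | h
  · exact key _ hab (fun z hz => by simp [hz]) h
  · exact key _ hbc (fun z hz => by simp [hz]) h
  · exact key _ hcd (fun z hz => by simp [hz]) h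
  · exact key _ hda (fun z hz => by simp [hz]) h

lemma face_cycle' (hq : Quad D) {U : Set (ℝ × ℝ)} (hU : IsFace D U) :
    ∃ a b c d, G.Adj a b ∧ G.Adj b c ∧ G.Adj c d ∧ G.Adj d a ∧ a ≠ c ∧ b ≠ d ∧
      frontier U = arcset D s(a, b) ∪ arcset D s(b, c) ∪ arcset D s(c, d) ∪ arcset D s(d, a) ∧
      ∀ e, onBd D U e ↔ (e = s(a, b) ∨ e = s(b, c) ∨ e = s(c, d) ∨ e = s(d, a)) := by
  obtain ⟨a, b, c, d, hab, hbc, hcd, hda, h1, h2, h3⟩ := face_cycle hq hU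
  refine ⟨a, b, c, d, hab, hbc, hcd, hda, h1, h2, h3, ?_⟩
  intro e
  constructor
  · rintro ⟨he, hs⟩
    obtain ⟨x, hx1, hx2⟩ := exists_mid D he
    have := hs hx1
    rw [h3] at this
    rcases this with ((h | h) | h) | h
    · exact Or.inl (mid_eq hab hx2 h).symm
    · exact Or.inr (Or.inl (mid_eq hbc hx2 h).symm)
    · exact Or.inr (Or.inr (Or.inl (mid_eq hcd hx2 h).symm))
    · exact Or.inr (Or.inr (Or.inr (mid_eq hda hx2 h).symm))
  · rintro (rfl | rfl | rfl | rfl)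
    · exact ⟨hab, h3 ▸ fun z hz => by simp [hz]⟩
    · exact ⟨hbc, h3 ▸ fun z hz => by simp [hz]⟩
    · exact ⟨hcd, h3 ▸ fun z hz => by simp [hz]⟩
    · exact ⟨hda, h3 ▸ fun z hz => by simp [hz]⟩

/-- Two different faces sharing an edge: log of the quotient off this edge. -/
lemma pair_log {U U' : Set (ℝ × ℝ)} (hU : IsFace D U) (hU' : IsFace D U') {e : Sym2 V}
    (he : onBd D U e) (he' : onBd D U' e) {a a' : ℝ × ℝ} (ha : a ∈ U) (ha' : a' ∈ U') :
    HasLog (Kminus D e) (fun z => (zt z - zt a) / (zt z - zt a')) := by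
  obtain ⟨x, hx1, hx2⟩ := exists_mid D he.1
  have c1 : IsPreconnected (U ∪ {x}) := by
    apply hU.preconn.subset_closure subset_union_left
    refine union_subset subset_closure ?_
    rintro _ rfl
    exact frontier_subset_closure (he.2 hx1)
  have c2 : IsPreconnected (U' ∪ {x}) := by
    apply hU'.preconn.subset_closure subset_union_left
    refine union_subset subset_closure ?_
    rintro _ rfl
    exact frontier_subset_closure (he'.2 hx1)
  refine hasLog_of_joined (S := (U ∪ {x}) ∪ (U' ∪ {x})) (Kminus_compact D e)
    (c1.union x (by simp) (by simp) c2) ?_ (by simp [ha]) (by simp [ha'])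
  have hsub : Kminus D e ⊆ D.image := by rw [image_split D he.1]; exact subset_union_left
  rintro z ((h | h) | (h | h)) hz
  · exact hU.notMem h (hsub hz)
  · exact hx2 ((show z = x from h) ▸ hz)
  · exact hU'.notMem h (hsub hz)
  · exact hx2 ((show z = x from h) ▸ hz)

lemma no_log_faces {U U' : Set (ℝ × ℝ)} (hU : IsFace D U) (hU' : IsFace D U') (hne : U ≠ U')
    {a a' : ℝ × ℝ} (ha : a ∈ U) (ha' : a' ∈ U') :
    ¬ HasLog D.image (fun z => (zt z - zt a) / (zt z - zt a')) :=
  no_log_of_separated (image_compact D) hU.open hU.frontier_sub ha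
    (fun h => hne (hU.eq_of_mem hU' h ha')) (hU'.notMem ha')

lemma pair_ne {U U' : Set (ℝ × ℝ)} (hU : IsFace D U) (hU' : IsFace D U') (hne : U ≠ U')
    {u v : V} (h : G.Adj u v) {a a' : ℝ × ℝ} (ha : a ∈ U) (ha' : a' ∈ U')
    {g gE : ℝ × ℝ → ℂ} (c1 : ContinuousOn g (Kminus D s(u, v)))
    (e1 : ∀ z ∈ Kminus D s(u, v), Complex.exp (g z) = (zt z - zt a) / (zt z - zt a'))
    (c2 : ContinuousOn gE (arcset D s(u, v)))
    (e2 : ∀ z ∈ arcset D s(u, v), Complex.exp (gE z) = (zt z - zt a) / (zt z - zt a')) :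
    gE (D.vert v) - gE (D.vert u) ≠ g (D.vert v) - g (D.vert u) := fun hag =>
  no_log_faces hU hU' hne ha ha' (glue_ends D h c1 c2 e1 e2 hag)

/-- logs on the edges -/
lemma edge_log {U : Set (ℝ × ℝ)} (hU : IsFace D U) {e : Sym2 V} (he : e ∈ G.edgeSet)
    {a : ℝ × ℝ} (ha : a ∈ U) :
    HasLog (arcset D e) (fun z => zt z - zt a) := by
  apply arcset_log D he
  · exact (zt_cont.sub continuous_const).continuousOn
  · intro z hz
    exact zt_sub_ne (fun h => hU.notMem ha (h ▸ arcset_sub_image D he hz))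

lemma integral_diff {g g' : ℝ × ℝ → ℂ} {x y : ℝ × ℝ}
    (hx : Complex.exp (g x) = Complex.exp (g' x)) (hy : Complex.exp (g y) = Complex.exp (g' y)) :
    ∃ n : ℤ, (g y - g x) - (g' y - g' x) = n * (2 * Real.pi * Complex.I) := by
  obtain ⟨n, hn⟩ := Complex.exp_eq_exp_iff_exists_int.mp hx
  obtain ⟨m, hm⟩ := Complex.exp_eq_exp_iff_exists_int.mp hy
  refine ⟨m - n, ?_⟩
  push_cast
  linear_combination hm - hn

/-- At most two faces per edge. -/
lemma no_three {U₁ U₂ U₃ : Set (ℝ × ℝ)} (h1 : IsFace D U₁) (h2 : IsFace D U₂) (h3 : IsFace D U₃)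
    (h12 : U₁ ≠ U₂) (h23 : U₂ ≠ U₃) (h13 : U₁ ≠ U₃) {e : Sym2 V}
    (b1 : onBd D U₁ e) (b2 : onBd D U₂ e) (b3 : onBd D U₃ e) : False := by
  -- we may suppose that the first is bounded
  wlog hb : Bornology.IsBounded U₁ generalizing U₁ U₃
  · rcases bounded_or (image_compact D) h1.open h3.open (h1.disj h3 h13) h1.frontier_sub with h | h
    · exact hb h
    · exact this h3 h1 h23.symm h12.symm h13.symm b3 b1 h
  obtain ⟨a1, ha1⟩ := h1.nonempty
  obtain ⟨a2, ha2⟩ := h2.nonempty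
  obtain ⟨a3, ha3⟩ := h3.nonempty
  obtain ⟨g, cg, eg⟩ := pair_log h1 h2 b1 b2 ha1 ha2
  obtain ⟨g', cg', eg'⟩ := pair_log h2 h3 b2 b3 ha2 ha3
  obtain ⟨l1, cl1, el1⟩ := edge_log h1 b1.1 ha1
  obtain ⟨l2, cl2, el2⟩ := edge_log h2 b1.1 ha2
  obtain ⟨l3, cl3, el3⟩ := edge_log h3 b1.1 ha3
  induction e with | _ u v =>
  have h : G.Adj u v := b1.1
  have n12 := pair_ne h1 h2 h12 h ha1 ha2 cg eg (cl1.sub cl2)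
    (fun z hz => by rw [Pi.sub_apply, Complex.exp_sub, el1 z hz, el2 z hz])
  have n23 := pair_ne h2 h3 h23 h ha2 ha3 cg' eg' (cl2.sub cl3)
    (fun z hz => by rw [Pi.sub_apply, Complex.exp_sub, el2 z hz, el3 z hz])
  have ku : D.vert u ∈ Kminus D s(u, v) := Or.inl (mem_range_self _)
  have kv : D.vert v ∈ Kminus D s(u, v) := Or.inl (mem_range_self _)
  have au := left_mem_arcset D h
  have av := right_mem_arcset D h
  obtain ⟨p, hp⟩ := integral_diff (g := fun z => l1 z - l2 z) (g' := g) (x := D.vert u)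
    (y := D.vert v) (by rw [Complex.exp_sub, el1 _ au, el2 _ au, eg _ ku])
    (by rw [Complex.exp_sub, el1 _ av, el2 _ av, eg _ kv])
  obtain ⟨q, hq⟩ := integral_diff (g := fun z => l2 z - l3 z) (g' := g') (x := D.vert u)
    (y := D.vert v) (by rw [Complex.exp_sub, el2 _ au, el3 _ au, eg' _ ku])
    (by rw [Complex.exp_sub, el2 _ av, el3 _ av, eg' _ kv])
  have hq0 : q ≠ 0 := by
    rintro rfl
    apply n23
    simp only [Pi.sub_apply]
    simp at hq
    linear_combination hq
  have hne : ∀ {U : Set (ℝ × ℝ)} {a : ℝ × ℝ}, IsFace D U → a ∈ U → ∀ z ∈ D.image,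
      zt z - zt a ≠ 0 := fun hU ha z hz => zt_sub_ne (fun h => hU.notMem ha (h ▸ hz))
  apply hq0
  have hKm : Kminus D s(u, v) ⊆ D.image := by rw [image_split D b1.1]; exact subset_union_left
  have hcl : ∀ z ∈ closure U₁, ∀ {U : Set (ℝ × ℝ)} {a : ℝ × ℝ}, IsFace D U → U₁ ≠ U → a ∈ U →
      zt z - zt a ≠ 0 := by
    intro z hz U a hU hUne ha
    rcases h1.closure_sub hz with h | h
    · exact zt_sub_ne (fun h' => hUne (h1.eq_of_mem hU h (h' ▸ ha)))
    · exact hne hU ha z h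
  refine winding_zero (image_compact D).isClosed h1.open hb h1.frontier_sub ha1 q
    (h := fun z => (zt z - zt a2) ^ (-q - p) * (zt z - zt a3) ^ p) ?_ ?_ ?_
  · apply ContinuousOn.mul
    · exact ContinuousOn.zpow₀ (zt_cont.sub continuous_const).continuousOn _
        (fun z hz => Or.inl (hcl z hz h2 h12 ha2))
    · exact ContinuousOn.zpow₀ (zt_cont.sub continuous_const).continuousOn _
        (fun z hz => Or.inl (hcl z hz h3 h13 ha3))
  · intro z hz
    exact mul_ne_zero (zpow_ne_zero _ (hcl z hz h2 h12 ha2)) (zpow_ne_zero _ (hcl z hz h3 h13 ha3))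
  · have hF : ∀ z ∈ D.image, (zt z - zt a1) ^ q * ((zt z - zt a2) ^ (-q - p) * (zt z - zt a3) ^ p)
        = ((zt z - zt a1) / (zt z - zt a2)) ^ q / ((zt z - zt a2) / (zt z - zt a3)) ^ p := by
      intro z hz
      have i1 := hne h1 ha1 z hz
      have i2 := hne h2 ha2 z hz
      have i3 := hne h3 ha3 z hz
      rw [div_zpow, div_zpow, show (-q - p) = -q + -p by ring, zpow_add₀ i2, zpow_neg, zpow_neg]
      have := zpow_ne_zero q i2
      have := zpow_ne_zero p i2
      have := zpow_ne_zero p i3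
      field_simp
    refine glue_ends D h (g₁ := fun z => q * g z - p * g' z)
      (g₂ := fun z => q * (l1 z - l2 z) - p * (l2 z - l3 z)) ?_ ?_ ?_ ?_ ?_
    · exact (continuousOn_const.mul cg).sub (continuousOn_const.mul cg')
    · exact (continuousOn_const.mul (cl1.sub cl2)).sub (continuousOn_const.mul (cl2.sub cl3))
    · intro z hz
      rw [hF z (hKm hz), Complex.exp_sub, Complex.exp_int_mul, Complex.exp_int_mul, eg z hz,
        eg' z hz]
    · intro z hz
      rw [hF z (arcset_sub_image D b1.1 hz), Complex.exp_sub, Complex.exp_int_mul,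
        Complex.exp_int_mul, Complex.exp_sub, Complex.exp_sub, el1 z hz, el2 z hz, el3 z hz]
    · linear_combination (q : ℂ) * hp - (p : ℂ) * hq

end Faces
end QPO

set_option linter.unusedSectionVars false
namespace QPO
open Set Topology Filter

section Faces2
variable {V : Type*} [Fintype V] {G : SimpleGraph V} {D : PlaneDrawing G}

lemma bd_nonempty (hq : Quad D) {U : Set (ℝ × ℝ)} (hU : IsFace D U) : ∃ e, onBd D U e := by
  obtain ⟨a, b, c, d, hab, hbc, hcd, hda, h1, h2, h3, h4⟩ := face_cycle' hq hU
  exact ⟨_, (h4 s(a, b)).mpr (Or.inl rfl)⟩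

lemma faces_finite (hq : Quad D) : {U | IsFace D U}.Finite := by
  have : {U | IsFace D U} ⊆ ⋃ e : Sym2 V, {U | IsFace D U ∧ onBd D U e} := by
    intro U hU
    obtain ⟨e, he⟩ := bd_nonempty hq hU
    exact mem_iUnion.mpr ⟨e, hU, he⟩
  refine (Set.finite_iUnion fun e => ?_).subset this
  by_contra hinf
  obtain ⟨t, ht, hc⟩ := Set.Infinite.exists_subset_card_eq hinf 3
  obtain ⟨x, y, z, hxy, hxz, hyz, rfl⟩ := Finset.card_eq_three.mp hc
  have hx := ht (show x ∈ _ by simp)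
  have hy := ht (show y ∈ _ by simp)
  have hz := ht (show z ∈ _ by simp)
  exact no_three hx.1 hy.1 hz.1 hxy hyz hxz hx.2 hy.2 hz.2

lemma closure_cover (hq : Quad D) (x : ℝ × ℝ) : ∃ U, IsFace D U ∧ x ∈ closure U := by
  have hd : closure (D.image)ᶜ = univ := by
    rw [closure_compl, interior_image, compl_empty]
  have hsub : (D.image)ᶜ ⊆ ⋃ U ∈ {U | IsFace D U}, closure U := by
    intro z hz
    obtain ⟨U, hU, hzU⟩ := exists_face D hz
    exact mem_biUnion (show U ∈ {U | IsFace D U} from hU) (subset_closure hzU)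
  have hcl : IsClosed (⋃ U ∈ {U | IsFace D U}, closure U) :=
    (faces_finite hq).isClosed_biUnion fun _ _ => isClosed_closure
  have := closure_minimal hsub hcl (hd ▸ mem_univ x)
  simp only [mem_iUnion] at this
  obtain ⟨U, hU, h⟩ := this
  exact ⟨U, hU, h⟩

lemma frontier_of_closure {U : Set (ℝ × ℝ)} (hU : IsFace D U) {x : ℝ × ℝ} (hx : x ∈ closure U)
    (hK : x ∈ D.image) : x ∈ frontier U := by
  rw [hU.open.frontier_eq]; exact ⟨hx, fun h => hU.notMem h hK⟩

lemma exists_face_edge (hq : Quad D) {e : Sym2 V} (he : e ∈ G.edgeSet) :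
    ∃ U, IsFace D U ∧ onBd D U e := by
  obtain ⟨x, hx1, hx2⟩ := exists_mid D he
  obtain ⟨U, hU, hxU⟩ := closure_cover hq x
  exact ⟨U, hU, mid_frontier hq hU hx2 (frontier_of_closure hU hxU (arcset_sub_image D he hx1))⟩

lemma exists_other_face (hq : Quad D) (hdeg : ∀ v, 3 ≤ (G.neighborSet v).ncard)
    {U : Set (ℝ × ℝ)} (hU : IsFace D U) : ∃ U', IsFace D U' ∧ U' ≠ U := by
  obtain ⟨a, b, c, d, hab, hbc, hcd, hda, h1, h2, h3, h4⟩ := face_cycle' hq hU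
  have : ∃ w ∈ G.neighborSet a, w ∉ ({b, d} : Set V) := by
    by_contra hcon
    push Not at hcon
    have := Set.ncard_le_ncard (show G.neighborSet a ⊆ {b, d} from hcon) (Set.toFinite _)
    have h2 := Set.ncard_insert_le b {d}
    have := hdeg a
    simp at h2
    omega
  obtain ⟨w, hw, hw2⟩ := this
  have hw : G.Adj a w := hw
  simp only [mem_insert_iff, mem_singleton_iff, not_or] at hw2
  obtain ⟨U', hU', hb⟩ := exists_face_edge hq (show s(a, w) ∈ G.edgeSet from hw)
  refine ⟨U', hU', ?_⟩
  rintro rfl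
  have := hab.ne
  have := hda.ne
  have := (h4 _).mp hb
  simp only [Sym2.eq_iff] at this
  grind

lemma face_cycle_at (hq : Quad D) {U : Set (ℝ × ℝ)} (hU : IsFace D U) {e : Sym2 V}
    (he : onBd D U e) :
    ∃ a b c d, G.Adj a b ∧ G.Adj b c ∧ G.Adj c d ∧ G.Adj d a ∧ a ≠ c ∧ b ≠ d ∧ e = s(a, b) ∧
      frontier U = arcset D s(a, b) ∪ arcset D s(b, c) ∪ arcset D s(c, d) ∪ arcset D s(d, a) := by
  obtain ⟨a, b, c, d, hab, hbc, hcd, hda, h1, h2, h3, h4⟩ := face_cycle' hq hU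
  rcases (h4 e).mp he with h | h | h | h
  · exact ⟨a, b, c, d, hab, hbc, hcd, hda, h1, h2, h, h3⟩
  · exact ⟨b, c, d, a, hbc, hcd, hda, hab, h2, h1.symm, h, h3.trans (by ac_rfl)⟩
  · exact ⟨c, d, a, b, hcd, hda, hab, hbc, h1.symm, h2.symm, h, h3.trans (by ac_rfl)⟩
  · exact ⟨d, a, b, c, hda, hab, hbc, hcd, h2.symm, h1, h, h3.trans (by ac_rfl)⟩

lemma arc_point {u v u' v' : V} (h : G.Adj u v) (h' : G.Adj u' v') (hne : s(u, v) ≠ s(u', v'))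
    {z : ℝ × ℝ} (hz : z ∈ arcset D s(u, v)) (hz' : z ∈ arcset D s(u', v')) :
    ∃ w, z = D.vert w ∧ (w = u ∨ w = v) ∧ (w = u' ∨ w = v') := by
  rw [arcset_eq D h] at hz
  rw [arcset_eq D h'] at hz'
  exact range_inter D h h' hne hz hz'

/-- At least two faces per edge. -/
lemma exists_second (hq : Quad D) (hdeg : ∀ v, 3 ≤ (G.neighborSet v).ncard)
    {U : Set (ℝ × ℝ)} (hU : IsFace D U) {e : Sym2 V} (he : onBd D U e) :
    ∃ U', IsFace D U' ∧ U' ≠ U ∧ onBd D U' e := by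
  by_contra hcon
  push Not at hcon
  obtain ⟨U₂, hU₂, hU₂ne⟩ := exists_other_face hq hdeg hU
  obtain ⟨a, b, c, d, hab, hbc, hcd, hda, h1, h2, rfl, h3⟩ := face_cycle_at hq hU he
  have hKm : Kminus D s(a, b) ⊆ D.image := by rw [image_split D he.1]; exact subset_union_left
  set p := D.arc hab with hp
  have pinj : Function.Injective p := D.arc_inj hab
  let W : Set (ℝ × ℝ) := ⋃ U' ∈ {U' | IsFace D U' ∧ U' ≠ U}, closure U'
  have hWc : IsClosed W :=
    ((faces_finite hq).subset fun _ h => h.1).isClosed_biUnion fun _ _ => isClosed_closure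
  let N : Set (ℝ × ℝ) := (W ∪ Kminus D s(a, b))ᶜ
  have hNo : IsOpen N := (hWc.union (Kminus_compact D _).isClosed).isOpen_compl
  have hNsub : N ⊆ U ∪ arcset D s(a, b) := by
    intro z hz
    have hz1 : z ∉ W := fun h => hz (Or.inl h)
    have hz2 : z ∉ Kminus D s(a, b) := fun h => hz (Or.inr h)
    by_cases hzK : z ∈ D.image
    · rw [image_split D he.1] at hzK
      exact Or.inr (hzK.resolve_left hz2)
    · obtain ⟨U', hU', hzU'⟩ := exists_face D hzK
      by_cases hUU : U' = U
      · exact Or.inl (hUU ▸ hzU')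
      · exact absurd (mem_biUnion (show U' ∈ {U' | IsFace D U' ∧ U' ≠ U} from ⟨hU', hUU⟩)
          (subset_closure hzU')) hz1
  let m : unitInterval := ⟨1 / 2, by norm_num, by norm_num⟩
  have m0 : (0 : unitInterval) < m := by
    rw [← Subtype.coe_lt_coe]; simp [m]
  have m1 : m < (1 : unitInterval) := by
    rw [← Subtype.coe_lt_coe]; simp [m]; norm_num
  have hmN : p m ∈ N := by
    rintro (hW | hKK)
    · simp only [W, mem_iUnion] at hW
      obtain ⟨U', ⟨hU', hne⟩, hz⟩ := hW
      have hmid := mid_notMem D hab m0.ne' m1.ne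
      have := mid_frontier hq hU' hmid (frontier_of_closure hU' hz
        (arcset_sub_image D he.1 (by rw [arcset_eq D hab]; exact mem_range_self _)))
      exact hcon U' hU' hne this
    · exact mid_notMem D hab m0.ne' m1.ne hKK
  have hnb : p ⁻¹' N ∈ 𝓝 m := p.continuous.continuousAt.preimage_mem_nhds (hNo.mem_nhds hmN)
  obtain ⟨l, ⟨-, hl⟩, hlI⟩ := exists_Ioc_subset_of_mem_nhds' hnb m0
  obtain ⟨r, ⟨hr, -⟩, hrI⟩ := exists_Ico_subset_of_mem_nhds' hnb m1
  obtain ⟨s1, hs1, hs1'⟩ := exists_between hl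
  obtain ⟨s2, hs2, hs2'⟩ := exists_between hr
  have hIn : ∀ t, s1 < t → t < s2 → p t ∈ N := by
    intro t ht1 ht2
    rcases le_total t m with h | h
    · exact hlI ⟨hs1.trans ht1, h⟩
    · exact hrI ⟨h, ht2.trans hs2'⟩
  let e1 := p '' Iic s1
  let e2 := p '' Ici s2
  have e1c : IsClosed e1 := (isClosed_Iic.isCompact.image p.continuous).isClosed
  have e2c : IsClosed e2 := (isClosed_Ici.isCompact.image p.continuous).isClosed
  have e1s : e1 ⊆ arcset D s(a, b) := by rw [arcset_eq D hab]; exact image_subset_range _ _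
  have e2s : e2 ⊆ arcset D s(a, b) := by rw [arcset_eq D hab]; exact image_subset_range _ _
  have hbne : D.vert b ∉ e1 := by
    rintro ⟨t, ht, htb⟩
    have : t = 1 := pinj (htb.trans p.target.symm)
    subst this
    exact absurd (lt_of_le_of_lt (show (1 : unitInterval) ≤ s1 from ht) (hs1'.trans m1)) (lt_irrefl _)
  have hane : D.vert a ∉ e2 := by
    rintro ⟨t, ht, htb⟩
    have : t = 0 := pinj (htb.trans p.source.symm)
    subst this
    exact absurd (lt_of_lt_of_le (m0.trans hs2) (show s2 ≤ (0 : unitInterval) from ht)) (lt_irrefl _)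
  have n1 : s(b, c) ≠ s(a, b) := by
    intro h; rw [Sym2.eq_iff] at h; grind [hab.ne, hbc.ne]
  have n2 : s(c, d) ≠ s(a, b) := by
    intro h; rw [Sym2.eq_iff] at h; grind [hab.ne, hbc.ne]
  have n3 : s(d, a) ≠ s(a, b) := by
    intro h; rw [Sym2.eq_iff] at h; grind [hab.ne, hbc.ne]
  have n4 : s(b, c) ≠ s(c, d) := by
    intro h; rw [Sym2.eq_iff] at h; grind [hab.ne, hbc.ne]
  have n5 : s(b, c) ≠ s(d, a) := by
    intro h; rw [Sym2.eq_iff] at h; grind [hab.ne, hbc.ne]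
  have n6 : s(c, d) ≠ s(d, a) := by
    intro h; rw [Sym2.eq_iff] at h; grind [hab.ne, hbc.ne]
  set B := arcset D s(b, c) ∪ arcset D s(c, d) ∪ arcset D s(d, a) with hB
  have hBK : B ⊆ Kminus D s(a, b) :=
    union_subset (union_subset (arcset_sub_Kminus D hbc n1) (arcset_sub_Kminus D hcd n2))
      (arcset_sub_Kminus D hda n3)
  have hBc : IsClosed B := ((arcset_compact D (show s(b, c) ∈ G.edgeSet from hbc)).isClosed.union
    (arcset_compact D (show s(c, d) ∈ G.edgeSet from hcd)).isClosed).union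
      (arcset_compact D (show s(d, a) ∈ G.edgeSet from hda)).isClosed
  have hA : B ∪ e1 ∪ e2 ⊆ D.image :=
    union_subset (union_subset (hBK.trans hKm) (e1s.trans (arcset_sub_image D he.1)))
      (e2s.trans (arcset_sub_image D he.1))
  let O := U ∪ (N \ (e1 ∪ e2))
  have hO : IsOpen O := hU.open.union (hNo.sdiff (e1c.union e2c))
  have hOs : O ⊆ U ∪ arcset D s(a, b) :=
    union_subset subset_union_left (Set.sdiff_subset.trans hNsub)
  have hfr : frontier O ⊆ B ∪ e1 ∪ e2 := by
    intro z hz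
    rw [hO.frontier_eq] at hz
    have hz1 := closure_mono hOs hz.1
    rw [closure_union, (arcset_compact D he.1).isClosed.closure_eq,
      closure_eq_self_union_frontier, h3] at hz1
    have hzU : z ∉ U := fun h => hz.2 (Or.inl h)
    have hz2 : z ∈ B ∨ z ∈ arcset D s(a, b) := by
      rcases hz1 with (h | (((h | h) | h) | h)) | h
      · exact absurd h hzU
      · exact Or.inr h
      · exact Or.inl (Or.inl (Or.inl h))
      · exact Or.inl (Or.inl (Or.inr h))
      · exact Or.inl (Or.inr h)
      · exact Or.inr h
    rcases hz2 with h | h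
    · exact Or.inl (Or.inl h)
    · rw [arcset_eq D hab] at h
      obtain ⟨t, rfl⟩ := h
      by_cases ht1 : t ≤ s1
      · exact Or.inl (Or.inr ⟨t, ht1, rfl⟩)
      by_cases ht2 : s2 ≤ t
      · exact Or.inr ⟨t, ht2, rfl⟩
      exfalso
      apply hz.2
      refine Or.inr ⟨hIn t (not_le.mp ht1) (not_le.mp ht2), ?_⟩
      rintro (⟨t', ht', h⟩ | ⟨t', ht', h⟩)
      · exact ht1 (pinj h ▸ ht')
      · exact ht2 (pinj h ▸ ht')
  obtain ⟨a0, ha0⟩ := hU.nonempty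
  obtain ⟨b0, hb0⟩ := hU₂.nonempty
  have hAcomp : IsCompact (B ∪ e1 ∪ e2) :=
    (image_compact D).of_isClosed_subset ((hBc.union e1c).union e2c) hA
  refine no_log_of_separated hAcomp hO hfr (Or.inl ha0) (b := b0) ?_
    (fun h => hU₂.notMem hb0 (hA h)) ?_
  · rintro (h | h)
    · exact hU₂ne (hU₂.eq_of_mem hU hb0 h)
    · exact h.1 (Or.inl (mem_biUnion (show U₂ ∈ {U' | IsFace D U' ∧ U' ≠ U} from ⟨hU₂, hU₂ne⟩)
          (subset_closure hb0)))
  set f := fun z => (zt z - zt a0) / (zt z - zt b0)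
  have hf : ∀ {e : Sym2 V}, e ∈ G.edgeSet → HasLog (arcset D e) f := by
    intro e he
    obtain ⟨g, cg, eg⟩ := edge_log hU he ha0
    obtain ⟨g', cg', eg'⟩ := edge_log hU₂ he hb0
    exact ⟨g - g', cg.sub cg', fun z hz => by
      rw [Pi.sub_apply, Complex.exp_sub, eg z hz, eg' z hz]⟩
  have cl : ∀ {u v : V}, G.Adj u v → IsClosed (arcset D s(u, v)) := fun h =>
    (arcset_compact D (show s(_, _) ∈ G.edgeSet from h)).isClosed
  have L1 : HasLog (arcset D s(b, c) ∪ arcset D s(c, d)) f := by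
    refine glue_point (cl hbc) (cl hcd) (hf hbc) (hf hcd) (D.vert c) (right_mem_arcset D hbc)
      (left_mem_arcset D hcd) ?_
    intro z hz hz'
    obtain ⟨w, rfl, hw1, hw2⟩ := arc_point hbc hcd n4 hz hz'
    congr 1; grind [hbc.ne]
  have L2 : HasLog B f := by
    refine glue_point ((cl hbc).union (cl hcd)) (cl hda) L1 (hf hda) (D.vert d)
      (Or.inr (right_mem_arcset D hcd)) (left_mem_arcset D hda) ?_
    rintro z (hz | hz) hz'
    · obtain ⟨w, rfl, hw1, hw2⟩ := arc_point hbc hda n5 hz hz'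
      congr 1; grind [hab.ne, hcd.ne]
    · obtain ⟨w, rfl, hw1, hw2⟩ := arc_point hcd hda n6 hz hz'
      congr 1; grind [hab.ne, hcd.ne]
  have L3 : HasLog (B ∪ e1) f := by
    refine glue_point hBc e1c L2 ((hf he.1).mono e1s) (D.vert a)
      (Or.inr (right_mem_arcset D hda)) ⟨0, bot_le (a := s1), p.source⟩ ?_
    intro z hz hz'
    rcases Kminus_inter D hab (hBK hz) (e1s hz') with h | h
    · exact h
    · exact absurd (h ▸ hz') hbne
  refine glue_point (hBc.union e1c) e2c L3 ((hf he.1).mono e2s) (D.vert b)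
      (Or.inl (Or.inl (Or.inl (left_mem_arcset D hbc)))) ⟨1, le_top (a := s2), p.target⟩ ?_
  rintro z (hz | hz) hz'
  · rcases Kminus_inter D hab (hBK hz) (e2s hz') with h | h
    · exact absurd (h ▸ hz') hane
    · exact h
  · obtain ⟨t, ht, rfl⟩ := hz
    obtain ⟨t', ht', h⟩ := hz'
    have := pinj h
    subst this
    exact absurd ((hs1'.trans hs2).trans_le (show s2 ≤ t' from ht')) (not_lt.mpr ht)

/-- The dual graph is connected. -/
lemma dual_conn (hq : Quad D) (Q : Set (Set (ℝ × ℝ))) (hQf : ∀ U ∈ Q, IsFace D U)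
    (hQ : Q.Nonempty)
    (hcl : ∀ U ∈ Q, ∀ U' e, IsFace D U' → onBd D U e → onBd D U' e → U' ∈ Q)
    {U' : Set (ℝ × ℝ)} (hU' : IsFace D U') : U' ∈ Q := by
  by_contra hU'Q
  have hrank : 1 < Module.rank ℝ (ℝ × ℝ) := by
    rw [rank_prod']; simp; norm_num
  have hP : IsConnected (range D.vert)ᶜ :=
    (Set.finite_range D.vert).countable.isConnected_compl_of_one_lt_rank hrank
  obtain ⟨U, hUQ⟩ := hQ
  have hU := hQf U hUQ
  have key := isPreconnected_closed_iff.mp hP.isPreconnected (⋃ U ∈ Q, closure U)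
    (⋃ U ∈ {U | IsFace D U ∧ U ∉ Q}, closure U)
    (((faces_finite hq).subset hQf).isClosed_biUnion fun _ _ => isClosed_closure)
    (((faces_finite hq).subset fun _ h => h.1).isClosed_biUnion fun _ _ => isClosed_closure)
    ?_ ?_ ?_
  · obtain ⟨z, hz, hz1, hz2⟩ := key
    simp only [mem_iUnion] at hz1 hz2
    obtain ⟨U₁, h1, hz1⟩ := hz1
    obtain ⟨U₂, ⟨h2, h2Q⟩, hz2⟩ := hz2
    have h1' := hQf _ h1
    by_cases hzK : z ∈ D.image
    · have hzK' := hzK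
      rw [image_eq] at hzK'
      rcases hzK' with h | h
      · exact hz h
      · simp only [mem_iUnion] at h
        obtain ⟨e, he, hze⟩ := h
        have hzm : z ∉ Kminus D e := by
          intro hk
          induction e with | _ u v =>
          rcases Kminus_inter D he hk hze with h | h
          · exact hz ⟨_, h.symm⟩
          · exact hz ⟨_, h.symm⟩
        exact h2Q (hcl U₁ h1 U₂ e h2 (mid_frontier hq h1' hzm (frontier_of_closure h1' hz1 hzK))
          (mid_frontier hq h2 hzm (frontier_of_closure h2 hz2 hzK)))
    · have a1 := (h1'.closure_sub hz1).resolve_right hzK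
      have a2 := (h2.closure_sub hz2).resolve_right hzK
      exact h2Q (h1'.eq_of_mem h2 a1 a2 ▸ h1)
  · intro z _
    obtain ⟨W, hW, hzW⟩ := closure_cover hq z
    by_cases hWQ : W ∈ Q
    · exact Or.inl (mem_biUnion hWQ hzW)
    · exact Or.inr (mem_biUnion (show W ∈ {U | IsFace D U ∧ U ∉ Q} from ⟨hW, hWQ⟩) hzW)
  · obtain ⟨z, hz⟩ := hU.nonempty
    refine ⟨z, fun h => hU.notMem hz (Or.inl h), mem_biUnion hUQ (subset_closure hz)⟩
  · obtain ⟨z, hz⟩ := hU'.nonempty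
    refine ⟨z, fun h => hU'.notMem hz (Or.inl h),
      mem_biUnion (show U' ∈ {U | IsFace D U ∧ U ∉ Q} from ⟨hU', hU'Q⟩) (subset_closure hz)⟩

end Faces2

/-- Combinatorial data extracted from a quadrangulation. -/
structure QData {V : Type*} (G : SimpleGraph V) (Φ : Type) where
  bd : Φ → Sym2 V → Prop
  Δ : Φ → V → V → ℂ
  cyc : ∀ U, ∃ a b c d, G.Adj a b ∧ G.Adj b c ∧ G.Adj c d ∧ G.Adj d a ∧ a ≠ c ∧ b ≠ d ∧
    ∀ e, bd U e ↔ (e = s(a, b) ∨ e = s(b, c) ∨ e = s(c, d) ∨ e = s(d, a))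
  two : ∀ e ∈ G.edgeSet, ∃ U U', U ≠ U' ∧ ∀ W, bd W e ↔ (W = U ∨ W = U')
  dual : ∀ Q : Set Φ, Q.Nonempty → (∀ U ∈ Q, ∀ U' e, bd U e → bd U' e → U' ∈ Q) → ∀ U, U ∈ Q
  anti : ∀ U x y, G.Adj x y → Δ U y x = - Δ U x y
  jump : ∀ U U' u v, G.Adj u v → U ≠ U' → bd U s(u, v) → bd U' s(u, v) →
    ∃ (l : V → ℂ) (m : ℂ), m ≠ 0 ∧ Δ U u v - Δ U' u v = l v - l u + m ∧
      ∀ x y, G.Adj x y → s(x, y) ≠ s(u, v) → Δ U x y - Δ U' x y = l y - l x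

lemma exists_qdata {V : Type*} [Fintype V] (G : SimpleGraph V) (hquad : IsQuadrangulation G)
    (hdeg : ∀ v, 3 ≤ (G.neighborSet v).ncard) :
    ∃ Φ : Type, Finite Φ ∧ Nonempty Φ ∧ Nonempty (QData G Φ) := by
  classical
  obtain ⟨-, D, hq⟩ := hquad
  have hq : Quad D := hq
  have hfin : Finite {U : Set (ℝ × ℝ) // IsFace D U} := (faces_finite hq).to_subtype
  refine ⟨{U : Set (ℝ × ℝ) // IsFace D U}, hfin, ?_, ?_⟩
  · obtain ⟨U, hU, -⟩ := closure_cover hq (0, 0)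
    exact ⟨⟨U, hU⟩⟩
  have hpt : ∀ U : {U : Set (ℝ × ℝ) // IsFace D U}, ∃ a, a ∈ U.1 := fun U => U.2.nonempty
  choose pt hpt using hpt
  have hlog : ∀ (U : {U : Set (ℝ × ℝ) // IsFace D U}) (e : Sym2 V), ∃ g : ℝ × ℝ → ℂ,
      e ∈ G.edgeSet → ContinuousOn g (arcset D e) ∧
        ∀ z ∈ arcset D e, Complex.exp (g z) = zt z - zt (pt U) := by
    intro U e
    by_cases he : e ∈ G.edgeSet
    · obtain ⟨g, h1, h2⟩ := edge_log U.2 he (hpt U)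
      exact ⟨g, fun _ => ⟨h1, h2⟩⟩
    · exact ⟨0, fun h => absurd h he⟩
  choose g hg using hlog
  refine ⟨{ bd := fun U e => onBd D U.1 e
            Δ := fun U x y => g U s(x, y) (D.vert y) - g U s(x, y) (D.vert x)
            cyc := ?_, two := ?_, dual := ?_, anti := ?_, jump := ?_ }⟩
  · intro U
    obtain ⟨a, b, c, d, hab, hbc, hcd, hda, h1, h2, h3, h4⟩ := face_cycle' hq U.2
    exact ⟨a, b, c, d, hab, hbc, hcd, hda, h1, h2, h4⟩
  · intro e he
    obtain ⟨U, hU, hb⟩ := exists_face_edge hq he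
    obtain ⟨U', hU', hne, hb'⟩ := exists_second hq hdeg hU hb
    refine ⟨⟨U, hU⟩, ⟨U', hU'⟩, fun h => hne (congrArg Subtype.val h).symm, ?_⟩
    rintro ⟨W, hW⟩
    constructor
    · intro hbW
      by_contra hcon
      push Not at hcon
      exact no_three hU hU' hW hne.symm (fun h => hcon.2 (Subtype.ext h.symm))
        (fun h => hcon.1 (Subtype.ext h.symm)) hb hb' hbW
    · rintro (h | h)
      · cases h; exact hb
      · cases h; exact hb'
  · intro Q hQ hcl U
    have := dual_conn hq (Subtype.val '' Q) (by rintro _ ⟨W, -, rfl⟩; exact W.2) (hQ.image _) ?_ U.2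
    · obtain ⟨W, hW, h⟩ := this
      exact Subtype.ext h ▸ hW
    · rintro _ ⟨W, hW, rfl⟩ W' e hW' h1 h2
      exact ⟨⟨W', hW'⟩, hcl W hW ⟨W', hW'⟩ e h1 h2, rfl⟩
  · intro U x y h
    simp only [Sym2.eq_swap (a := y) (b := x)]
    ring
  · intro U U' u v h hne hb hb'
    obtain ⟨f, cf, ef⟩ := pair_log U.2 U'.2 hb hb' (hpt U) (hpt U')
    have hG : ∀ e ∈ G.edgeSet, ContinuousOn (g U e - g U' e) (arcset D e) ∧
        ∀ z ∈ arcset D e, Complex.exp ((g U e - g U' e) z) =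
          (zt z - zt (pt U)) / (zt z - zt (pt U')) := by
      intro e he
      refine ⟨(hg U e he).1.sub (hg U' e he).1, fun z hz => ?_⟩
      rw [Pi.sub_apply, Complex.exp_sub, (hg U e he).2 z hz, (hg U' e he).2 z hz]
    refine ⟨fun w => f (D.vert w), (g U s(u, v) - g U' s(u, v)) (D.vert v) -
      (g U s(u, v) - g U' s(u, v)) (D.vert u) - (f (D.vert v) - f (D.vert u)), ?_, ?_, ?_⟩
    · exact sub_ne_zero.mpr (pair_ne U.2 U'.2 (fun h => hne (Subtype.ext h)) h (hpt U) (hpt U')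
        cf ef (hG _ h).1 (hG _ h).2)
    · simp only [Pi.sub_apply]; ring
    · intro x y hxy hxyne
      have hs := arcset_sub_Kminus D (show s(x, y) ∈ G.edgeSet from hxy) hxyne
      have := log_const (arcset_preconn D (show s(x, y) ∈ G.edgeSet from hxy)) (hG _ hxy).1
        (cf.mono hs) (fun z hz => by rw [(hG _ hxy).2 z hz, ef z (hs hz)])
        (right_mem_arcset D hxy) (left_mem_arcset D hxy)
      simp only [Pi.sub_apply] at this
      linear_combination this

end QPO

set_option linter.unusedSectionVars false
namespace QPO
open Finset

section Comb
open scoped Classical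
variable {V : Type*} [Fintype V] {G : SimpleGraph V} {Φ : Type} [Fintype Φ] (R : QData G Φ)

/-- boundary edges of a face, as a finset. -/
noncomputable def bdF (U : Φ) : Finset (Sym2 V) := G.edgeFinset.filter (R.bd U)

lemma bd_edge {U : Φ} {e : Sym2 V} (h : R.bd U e) : e ∈ G.edgeSet := by
  obtain ⟨a, b, c, d, hab, hbc, hcd, hda, h1, h2, h4⟩ := R.cyc U
  rcases (h4 e).mp h with rfl | rfl | rfl | rfl <;> simpa

lemma mem_bdF {U : Φ} {e : Sym2 V} : e ∈ bdF R U ↔ R.bd U e := by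
  simp only [bdF, mem_filter, SimpleGraph.mem_edgeFinset]
  exact ⟨fun h => h.2, fun h => ⟨bd_edge R h, h⟩⟩

lemma bdF_sum (U : Φ) {M : Type*} [AddCommMonoid M] (f : Sym2 V → M) :
    ∃ a b c d, a ≠ b ∧ b ≠ c ∧ c ≠ d ∧ d ≠ a ∧ a ≠ c ∧ b ≠ d ∧
    ∑ e ∈ bdF R U, f e = f s(a, b) + (f s(b, c) + (f s(c, d) + f s(d, a))) := by
  obtain ⟨a, b, c, d, hab, hbc, hcd, hda, h1, h2, h4⟩ := R.cyc U
  refine ⟨a, b, c, d, hab.ne, hbc.ne, hcd.ne, hda.ne, h1, h2, ?_⟩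
  have : bdF R U = {s(a, b), s(b, c), s(c, d), s(d, a)} := by
    ext e; rw [mem_bdF, h4]; simp
  have := hab.ne
  have := hbc.ne
  have := hcd.ne
  have := hda.ne
  rw [‹bdF R U = _›, sum_insert, sum_insert, sum_insert, sum_singleton]
  · simp only [mem_singleton, Sym2.eq_iff]; grind
  · simp only [mem_insert, mem_singleton, Sym2.eq_iff]; grind
  · simp only [mem_insert, mem_singleton, Sym2.eq_iff]; grind

lemma card_bdF (U : Φ) : #(bdF R U) = 4 := by
  obtain ⟨a, b, c, d, -, -, -, -, -, -, h⟩ := bdF_sum R U (fun _ => 1)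
  simpa using h

lemma even_bdF (U : Φ) (v : V) : ∑ e ∈ bdF R U, (if v ∈ e then 1 else 0 : ZMod 2) = 0 := by
  obtain ⟨a, b, c, d, h1, h2, h3, h4, h5, h6, h⟩ :=
    bdF_sum R U (fun e => (if v ∈ e then 1 else 0 : ZMod 2))
  rw [h]
  simp only [Sym2.mem_iff]
  have : (1 + 1 : ZMod 2) = 0 := by decide
  by_cases va : v = a
  · subst va; simp [h1, h5, h4.symm, this]
  by_cases vb : v = b
  · subst vb; simp [h1.symm, h2, h6, this]
  by_cases vc : v = c
  · subst vc; simp [va, vb, h3, this]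
  by_cases vd : v = d
  · subst vd; simp [va, vb, vc, this]
  simp [va, vb, vc, vd]

lemma filter_two {e : Sym2 V} (he : e ∈ G.edgeSet) : ∃ U U', U ≠ U' ∧
    (univ.filter fun W => R.bd W e) = {U, U'} := by
  obtain ⟨U, U', hne, h⟩ := R.two e he
  exact ⟨U, U', hne, by ext W; simp [h]⟩

lemma two_mul_card (R : QData G Φ) : 2 * #G.edgeFinset = 4 * Fintype.card Φ := by
  have := Finset.sum_card_bipartiteAbove_eq_sum_card_bipartiteBelow (s := (univ : Finset Φ))
    (t := G.edgeFinset) R.bd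
  have h1 : ∀ U ∈ (univ : Finset Φ), #(bipartiteAbove R.bd G.edgeFinset U) = 4 :=
    fun U _ => card_bdF R U
  have h2 : ∀ e ∈ G.edgeFinset, #(bipartiteBelow R.bd (univ : Finset Φ) e) = 2 := by
    intro e he
    obtain ⟨U, U', hne, h⟩ := filter_two R (SimpleGraph.mem_edgeFinset.mp he)
    unfold bipartiteBelow
    rw [h, card_pair hne]
  rw [sum_congr rfl h1, sum_congr rfl h2] at this
  simp at this
  omega

lemma const_of_adj (hc : G.Connected) {X : Type*} (f : V → X)
    (h : ∀ u v, G.Adj u v → f u = f v) (u v : V) : f u = f v := by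
  obtain ⟨p⟩ := hc.preconnected u v
  induction p with
  | nil => rfl
  | cons hh _ ih => exact (h _ _ hh).trans ih

lemma const_of_dual {X : Type*} (f : Φ → X)
    (h : ∀ U U' e, R.bd U e → R.bd U' e → f U = f U') (U U' : Φ) : f U = f U' := by
  have := R.dual {W | f W = f U} ⟨U, rfl⟩ (fun W hW W' e h1 h2 => (h W W' e h1 h2).symm.trans hW) U'
  exact this.symm

lemma rank_ge {m n : Type*} [Fintype m] [Fintype n] (A : Matrix m n (ZMod 2))
    (h : ∀ x, A.mulVec x = 0 → ∀ i j, x i = x j) : Fintype.card n ≤ A.rank + 1 := by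
  have := LinearMap.finrank_range_add_finrank_ker A.mulVecLin
  rw [Module.finrank_fintype_fun_eq_card] at this
  have h1 : Module.finrank (ZMod 2) (LinearMap.ker A.mulVecLin) ≤ 1 := by
    by_cases hn : Nonempty n
    · obtain ⟨i⟩ := hn
      have hinj : Function.Injective
          ((LinearMap.proj i : (n → ZMod 2) →ₗ[ZMod 2] ZMod 2).comp
            (LinearMap.ker A.mulVecLin).subtype) := by
        rw [← LinearMap.ker_eq_bot, LinearMap.ker_eq_bot']
        rintro ⟨x, hx⟩ h0
        ext j
        simp at h0 hx
        have := h x hx j i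
        simp [this, h0]
      simpa using LinearMap.finrank_le_finrank_of_injective hinj
    · have : Fintype.card n = 0 := Fintype.card_eq_zero_iff.mpr (not_nonempty_iff.mp hn)
      omega
  have h2 : A.rank = Module.finrank (ZMod 2) (LinearMap.range A.mulVecLin) := rfl
  omega

lemma euler_lower (R : QData G Φ) (hc : G.Connected) :
    Fintype.card V + Fintype.card Φ ≤ #G.edgeFinset + 2 := by
  let M : Matrix V G.edgeSet (ZMod 2) := Matrix.of fun v e => if v ∈ e.1 then 1 else 0
  let N : Matrix G.edgeSet Φ (ZMod 2) := Matrix.of fun e U => if R.bd U e.1 then 1 else 0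
  have hMN : M * N = 0 := by
    ext v U
    simp only [Matrix.mul_apply, M, N, Matrix.of_apply, mul_ite, mul_one, mul_zero, Matrix.zero_apply]
    have := even_bdF R U v
    rw [bdF, sum_filter] at this
    refine Eq.trans ?_ this
    rw [← Finset.sum_coe_sort G.edgeFinset]
    refine Fintype.sum_equiv (Equiv.subtypeEquivRight (by simp)) _ _ ?_
    intro e
    rfl
  have h2 : ∀ a b : ZMod 2, a + b = 0 → a = b := by decide
  have r1 : Fintype.card V ≤ M.rank + 1 := by
    rw [← Matrix.rank_transpose]
    apply rank_ge
    intro x hx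
    refine const_of_adj hc x ?_
    intro u v huv
    have := congrFun hx ⟨s(u, v), huv⟩
    simp only [Matrix.mulVec, dotProduct, Matrix.transpose_apply, M, Matrix.of_apply, ite_mul, one_mul, zero_mul,
      Pi.zero_apply, Sym2.mem_iff] at this
    rw [← sum_filter, show (univ.filter fun a => a = u ∨ a = v) = {u, v} by ext; simp,
      sum_pair huv.ne] at this
    exact h2 _ _ this
  have r2 : Fintype.card Φ ≤ N.rank + 1 := by
    apply rank_ge
    intro x hx
    refine const_of_dual R x ?_
    intro U U' e hU hU'
    have he := bd_edge R hU
    have := congrFun hx ⟨e, he⟩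
    simp only [Matrix.mulVec, dotProduct, N, Matrix.of_apply, ite_mul, one_mul, zero_mul, Pi.zero_apply] at this
    obtain ⟨W, W', hne, hW⟩ := filter_two R he
    rw [← sum_filter, hW, sum_pair hne] at this
    have hh : ∀ Y, R.bd Y e → Y = W ∨ Y = W' := by
      intro Y hY
      have : Y ∈ (univ.filter fun W => R.bd W e) := by simp [hY]
      rw [hW] at this; simpa using this
    have h3 := h2 _ _ this
    rcases hh U hU with rfl | rfl <;> rcases hh U' hU' with rfl | rfl <;> simp [h3]
  have := Matrix.rank_add_rank_le_card_of_mul_eq_zero hMN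
  have hcard : Fintype.card G.edgeSet = #G.edgeFinset := by
    rw [SimpleGraph.edgeFinset_card]
  omega

lemma bool_three {x y z : Bool} (h1 : x ≠ y) (h2 : x ≠ z) (h3 : y ≠ z) :
    False := by
  revert x y z; decide

/-- A nonempty even edge set of a bipartite graph has at least four edges. -/
lemma four_le {c : V → Bool} (hbip : ∀ u v, G.Adj u v → c u ≠ c v) (F : Finset (Sym2 V))
    (hF : ∀ e ∈ F, e ∈ G.edgeSet) (hne : F.Nonempty)
    (hev : ∀ v, ∑ e ∈ F, (if v ∈ e then 1 else 0 : ZMod 2) = 0) : 4 ≤ #F := by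
  have key : ∀ u v, s(u, v) ∈ F → ∃ w, w ≠ v ∧ s(u, w) ∈ F := by
    intro u v huv
    by_contra hcon
    push Not at hcon
    have h := hev u
    rw [← sum_filter, show (F.filter fun e => u ∈ e) = {s(u, v)} from ?_] at h
    · simp at h
    · ext e
      simp only [mem_filter, mem_singleton]
      constructor
      · rintro ⟨he, hu⟩
        obtain ⟨w, rfl⟩ := hu
        by_contra hne
        exact hcon w (fun h => hne (by rw [h])) he
      · rintro rfl
        exact ⟨huv, by simp⟩
  obtain ⟨e, he⟩ := hne
  induction e with | _ u v =>
  obtain ⟨v', hv', h1⟩ := key u v he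
  obtain ⟨u', hu', h2⟩ := key v u (by rwa [Sym2.eq_swap])
  obtain ⟨v'', hv'', h3⟩ := key u' v (by rwa [Sym2.eq_swap])
  have b0 : c u ≠ c v := hbip _ _ (hF _ he)
  have b1 : c u ≠ c v' := hbip _ _ (hF _ h1)
  have b2 : c v ≠ c u' := hbip _ _ (hF _ h2)
  have b3 : c u' ≠ c v'' := hbip _ _ (hF _ h3)
  have hsub : ({s(u, v), s(u, v'), s(v, u'), s(u', v'')} : Finset (Sym2 V)) ⊆ F := by
    intro e; simp only [mem_insert, mem_singleton]; rintro (rfl | rfl | rfl | rfl) <;> assumption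
  refine le_trans (le_of_eq ?_) (card_le_card hsub)
  have x1 : u ≠ v := by rintro rfl; exact b0 rfl
  have x2 : u' ≠ v' := fun h => by
    rw [← h] at b1; exact bool_three b0 b1 b2
  have x3 : u ≠ v'' := fun h => by
    rw [← h] at b3; exact bool_three b0 b3.symm b2
  rw [card_insert_of_notMem, card_insert_of_notMem, card_insert_of_notMem, card_singleton]
  all_goals clear * - x1 x2 x3 hu' hv' hv''
  · simp only [mem_singleton, Sym2.eq_iff]; grind
  · simp only [mem_insert, mem_singleton, Sym2.eq_iff]; grind
  · simp only [mem_insert, mem_singleton, Sym2.eq_iff]; grind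

end Comb
end QPO

set_option linter.unusedSectionVars false
namespace QPO
open Finset

section Sparse
open scoped Classical
variable {V : Type*} [Fintype V] {G : SimpleGraph V} {Φ : Type} [Fintype Φ] (R : QData G Φ)

/-- The dual graph, without crossing the edges of `S`. -/
def dualG (S : Finset (Sym2 V)) : SimpleGraph Φ where
  Adj U U' := U ≠ U' ∧ ∃ e, e ∉ S ∧ R.bd U e ∧ R.bd U' e
  symm := ⟨fun _ _ ⟨h, e, h1, h2, h3⟩ => ⟨h.symm, e, h1, h3, h2⟩⟩
  loopless := ⟨fun _ h => h.1 rfl⟩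

/-- The component of a face. -/
def cmp (S : Finset (Sym2 V)) (U : Φ) : (dualG R S).ConnectedComponent :=
  (dualG R S).connectedComponentMk U

lemma cmp_eq {S : Finset (Sym2 V)} {U U' : Φ} {e : Sym2 V} (he : e ∉ S) (h : R.bd U e)
    (h' : R.bd U' e) : cmp R S U = cmp R S U' := by
  by_cases hne : U = U'
  · rw [hne]
  · exact SimpleGraph.ConnectedComponent.sound
      (SimpleGraph.Adj.reachable (show (dualG R S).Adj U U' from ⟨hne, e, he, h, h'⟩))

/-- The boundary of a component. -/
noncomputable def bQ (S : Finset (Sym2 V)) (Q : (dualG R S).ConnectedComponent) :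
    Finset (Sym2 V) :=
  S.filter fun e => ∃ U U', R.bd U e ∧ R.bd U' e ∧ cmp R S U = Q ∧ cmp R S U' ≠ Q

lemma bQ_nonempty {S : Finset (Sym2 V)} {Q Q' : (dualG R S).ConnectedComponent} (hne : Q' ≠ Q) :
    (bQ R S Q).Nonempty := by
  by_contra hcon
  rw [not_nonempty_iff_eq_empty] at hcon
  obtain ⟨U, rfl⟩ := Q.exists_rep
  obtain ⟨U', rfl⟩ := Q'.exists_rep
  have := R.dual {W | cmp R S W = cmp R S U} ⟨U, rfl⟩ ?_ U'
  · exact hne this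
  · intro W hW W' e h1 h2
    by_contra hW'
    have he : e ∈ S := by
      by_contra he
      exact hW' ((cmp_eq R he h1 h2).symm.trans hW)
    have : e ∈ bQ R S (cmp R S U) := by
      unfold bQ
      exact mem_filter.mpr ⟨he, W, W', h1, h2, hW, hW'⟩
    have h0 : bQ R S (cmp R S U) = ∅ := hcon
    rw [h0] at this
    simp at this

lemma bQ_even {S : Finset (Sym2 V)} (hS : S ⊆ G.edgeFinset)
    (Q : (dualG R S).ConnectedComponent) (v : V) :
    ∑ e ∈ bQ R S Q, (if v ∈ e then 1 else 0 : ZMod 2) = 0 := by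
  have h1 : ∑ U ∈ univ.filter (fun U => cmp R S U = Q), ∑ e ∈ bdF R U,
      (if v ∈ e then 1 else 0 : ZMod 2) = 0 := sum_eq_zero fun U _ => even_bdF R U v
  refine Eq.trans ?_ h1
  have h2 : bQ R S Q = G.edgeFinset.filter (fun e => e ∈ bQ R S Q) := by
    ext e
    simp only [mem_filter]
    exact ⟨fun h => ⟨hS (mem_filter.mp h).1, h⟩, fun h => h.2⟩
  rw [h2, sum_filter]
  simp only [bdF]
  conv_rhs => enter [2, U]; rw [sum_filter]
  rw [sum_comm]
  apply sum_congr rfl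
  intro e he
  rw [SimpleGraph.mem_edgeFinset] at he
  obtain ⟨W, W', hne, hW⟩ := filter_two R he
  have hb : ∀ Y, R.bd Y e ↔ Y = W ∨ Y = W' := by
    intro Y
    have : Y ∈ (univ.filter fun W => R.bd W e) ↔ Y ∈ ({W, W'} : Finset Φ) := by rw [hW]
    simpa using this
  conv_rhs => rw [← sum_filter, filter_filter, filter_congr (fun Y _ => and_comm),
    ← filter_filter, hW, sum_filter, sum_pair hne]
  have hin : e ∈ bQ R S Q ↔ ¬ (cmp R S W = Q ↔ cmp R S W' = Q) := by
    unfold bQ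
    rw [mem_filter]
    constructor
    · rintro ⟨-, U, U', h1, h2, h3, h4⟩
      rcases (hb U).mp h1 with rfl | rfl <;> rcases (hb U').mp h2 with rfl | rfl <;> tauto
    · intro h
      have heS : e ∈ S := by
        by_contra hh
        exact h (by rw [cmp_eq R hh ((hb W).mpr (Or.inl rfl)) ((hb W').mpr (Or.inr rfl))])
      refine ⟨heS, ?_⟩
      by_cases hc : cmp R S W = Q
      · exact ⟨W, W', (hb W).mpr (Or.inl rfl), (hb W').mpr (Or.inr rfl), hc, by tauto⟩
      · exact ⟨W', W, (hb W').mpr (Or.inr rfl), (hb W).mpr (Or.inl rfl), by tauto, hc⟩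
  simp only [hin]
  have h11 : (1 + 1 : ZMod 2) = 0 := by decide
  by_cases hv : v ∈ e <;> by_cases c1 : cmp R S W = Q <;> by_cases c2 : cmp R S W' = Q <;>
    simp [hv, c1, c2, h11]

lemma comps_bound {c : V → Bool} (hbip : ∀ u v, G.Adj u v → c u ≠ c v)
    {S : Finset (Sym2 V)} (hS : S ⊆ G.edgeFinset)
    (h2 : 2 ≤ Fintype.card (dualG R S).ConnectedComponent) :
    4 * Fintype.card (dualG R S).ConnectedComponent ≤ 2 * #S := by
  have h4 : ∀ Q ∈ (univ : Finset (dualG R S).ConnectedComponent), 4 ≤ #(bQ R S Q) := by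
    intro Q _
    obtain ⟨Q', hQ'⟩ := Fintype.exists_ne_of_one_lt_card h2 Q
    exact four_le hbip _
      (fun e he => SimpleGraph.mem_edgeFinset.mp (hS (mem_filter.mp he).1)) (bQ_nonempty R hQ')
      (bQ_even R hS Q)
  have := Finset.sum_card_bipartiteAbove_eq_sum_card_bipartiteBelow
    (s := (univ : Finset (dualG R S).ConnectedComponent))
    (t := S) (fun Q e => ∃ U U', R.bd U e ∧ R.bd U' e ∧ cmp R S U = Q ∧ cmp R S U' ≠ Q)
  have l1 := sum_le_sum h4
  have l2 : ∀ e ∈ S, #(bipartiteBelow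
      (fun Q e => ∃ U U', R.bd U e ∧ R.bd U' e ∧ cmp R S U = Q ∧ cmp R S U' ≠ Q)
      (univ : Finset (dualG R S).ConnectedComponent) e) ≤ 2 := by
    intro e he
    obtain ⟨W, W', hne, hb⟩ := R.two e (SimpleGraph.mem_edgeFinset.mp (hS he))
    refine le_trans (card_le_card (t := {cmp R S W, cmp R S W'}) ?_) card_le_two
    intro Q hQ
    simp only [bipartiteBelow, mem_filter, mem_univ, true_and] at hQ
    obtain ⟨U, U', h1, -, h3, -⟩ := hQ
    rcases (hb U).mp h1 with rfl | rfl <;> simp [h3]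
  have l3 := sum_le_sum l2
  have l4 : ∑ Q, #(bQ R S Q) ≤ ∑ e ∈ S, 2 := by
    refine le_trans (le_of_eq ?_) l3
    rw [← this]
    rfl
  have l5 := l1.trans l4
  simp only [sum_const, card_univ, smul_eq_mul] at l5
  omega

/-- Vertices of an edge set. -/
noncomputable def vS (S : Finset (Sym2 V)) : Finset V := univ.filter fun v => ∃ e ∈ S, v ∈ e

lemma lin_bound {S : Finset (Sym2 V)} (hS : S ⊆ G.edgeFinset) (hSn : S.Nonempty) [Nonempty Φ] :
    #S + 2 ≤ #(vS S) + Fintype.card (dualG R S).ConnectedComponent := by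
  have hex : ∀ e : Sym2 V, ∃ u v, e = s(u, v) := fun e => by
    induction e with | _ u v => exact ⟨u, v, rfl⟩
  choose tl hd hth using hex
  have hadj : ∀ e ∈ G.edgeSet, G.Adj (tl e) (hd e) := by
    intro e he
    rw [hth e] at he
    exact he
  have htv : ∀ e ∈ S, tl e ∈ vS S := fun e he =>
    mem_filter.mpr ⟨mem_univ _, e, he, (hth e).symm.subst (motive := fun x => tl e ∈ x) (Sym2.mem_mk_left _ _)⟩
  have hhv : ∀ e ∈ S, hd e ∈ vS S := fun e he =>
    mem_filter.mpr ⟨mem_univ _, e, he, (hth e).symm.subst (motive := fun x => hd e ∈ x) (Sym2.mem_mk_right _ _)⟩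
  obtain ⟨e0, he0⟩ := hSn
  let v0 := tl e0
  have hv0 : v0 ∈ vS S := htv e0 he0
  obtain ⟨U0⟩ := ‹Nonempty Φ›
  let c0 := cmp R S U0
  let bdry : (S → ℂ) → V → ℂ := fun γ v =>
    ∑ e : S, γ e * ((if hd e.1 = v then 1 else 0) - (if tl e.1 = v then 1 else 0))
  let w : (S → ℂ) → Φ → ℂ := fun γ U => ∑ e : S, γ e * R.Δ U (tl e.1) (hd e.1)
  let rep : (dualG R S).ConnectedComponent → Φ := Quot.out
  have hrep : ∀ Q, cmp R S (rep Q) = Q := fun Q => Quot.out_eq Q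
  let L : (S → ℂ) →ₗ[ℂ] ({v // v ∈ (vS S).erase v0} → ℂ) ×
      ({Q : (dualG R S).ConnectedComponent // Q ≠ c0} → ℂ) :=
    { toFun := fun γ => (fun v => bdry γ v.1, fun Q => w γ (rep Q.1) - w γ U0)
      map_add' := by
        intro x y
        ext i
        · simp [bdry, add_mul, sum_add_distrib]
        · simp only [w, Pi.add_apply, add_mul, sum_add_distrib, Prod.mk_add_mk]
          ring
      map_smul' := by
        intro r x
        ext i
        · simp [bdry, mul_assoc, mul_sum]
        · simp only [w, Pi.smul_apply, smul_eq_mul, mul_assoc, ← mul_sum, Prod.smul_mk,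
            RingHom.id_apply]
          ring }
  have hinj : Function.Injective L := by
    rw [← LinearMap.ker_eq_bot, LinearMap.ker_eq_bot']
    intro γ hγ
    have hγ1 : ∀ v ∈ (vS S).erase v0, bdry γ v = 0 := fun v hv =>
      congrFun (congrArg Prod.fst hγ) ⟨v, hv⟩
    have hγ2 : ∀ Q, Q ≠ c0 → w γ (rep Q) - w γ U0 = 0 := fun Q hQ =>
      congrFun (congrArg Prod.snd hγ) ⟨Q, hQ⟩
    have hout : ∀ v, v ∉ vS S → bdry γ v = 0 := by
      intro v hv
      apply sum_eq_zero
      intro e _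
      have h1 : hd e.1 ≠ v := fun h => hv (h ▸ hhv e.1 e.2)
      have h2 : tl e.1 ≠ v := fun h => hv (h ▸ htv e.1 e.2)
      simp [h1, h2]
    have hpair : ∀ l : V → ℂ, ∑ v, l v * bdry γ v = ∑ e : S, γ e * (l (hd e.1) - l (tl e.1)) := by
      intro l
      simp only [bdry, mul_sum]
      rw [sum_comm]
      apply sum_congr rfl
      intro e _
      have : ∀ v, l v * (γ e * ((if hd e.1 = v then 1 else 0) - (if tl e.1 = v then 1 else 0))) =
          γ e * ((if hd e.1 = v then l v else 0) - (if tl e.1 = v then l v else 0)) := by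
        intro v; split_ifs <;> ring
      simp only [this, ← mul_sum, sum_sub_distrib, sum_ite_eq, mem_univ, if_true]
    have hv00 : bdry γ v0 = 0 := by
      have h := hpair (fun _ => 1)
      simp only [one_mul, sub_self, mul_zero, sum_const_zero] at h
      rw [sum_eq_single v0] at h
      · exact h
      · intro v _ hv
        by_cases hvS : v ∈ vS S
        · exact hγ1 v (mem_erase.mpr ⟨hv, hvS⟩)
        · exact hout v hvS
      · simp
    have hall : ∀ v, bdry γ v = 0 := by
      intro v
      by_cases h : v = v0
      · rw [h, hv00]
      by_cases hvS : v ∈ vS S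
      · exact hγ1 v (mem_erase.mpr ⟨h, hvS⟩)
      · exact hout v hvS
    have hzero : ∀ l : V → ℂ, ∑ e : S, γ e * (l (hd e.1) - l (tl e.1)) = 0 := by
      intro l; rw [← hpair]; simp [hall]
    have hjump : ∀ U U' e, U ≠ U' → R.bd U e → R.bd U' e → ∃ m : ℂ, m ≠ 0 ∧
        w γ U - w γ U' = if h : e ∈ S then γ ⟨e, h⟩ * m else 0 := by
      intro U U' e hne hU hU'
      have he := bd_edge R hU
      rw [hth e] at hU hU'
      obtain ⟨l, m, hm, hj1, hj2⟩ := R.jump U U' (tl e) (hd e) (hadj e he) hne hU hU'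
      refine ⟨m, hm, ?_⟩
      have hterm : ∀ e' : S, γ e' * R.Δ U (tl e'.1) (hd e'.1) - γ e' * R.Δ U' (tl e'.1) (hd e'.1)
          = γ e' * (l (hd e'.1) - l (tl e'.1)) + if e'.1 = e then γ e' * m else 0 := by
        intro e'
        by_cases h : e'.1 = e
        · rw [if_pos h, ← mul_sub, h, hj1]; ring
        · rw [if_neg h, ← mul_sub, hj2 _ _ (hadj _ (SimpleGraph.mem_edgeFinset.mp (hS e'.2)))]
          · ring
          · rw [← hth, ← hth]; exact h
      simp only [w]
      rw [← sum_sub_distrib, sum_congr rfl (fun e' _ => hterm e'), sum_add_distrib, hzero, zero_add]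
      by_cases h : e ∈ S
      · rw [dif_pos h, sum_eq_single ⟨e, h⟩]
        · simp
        · intro b _ hb
          rw [if_neg]
          exact fun hh => hb (Subtype.ext hh)
        · simp
      · rw [dif_neg h]
        apply sum_eq_zero
        intro e' _
        rw [if_neg]
        rintro rfl
        exact h e'.2
    have hcomp : ∀ U U', cmp R S U = cmp R S U' → w γ U = w γ U' := by
      intro U U' h
      obtain ⟨p⟩ := SimpleGraph.ConnectedComponent.exact h
      induction p with
      | nil => rfl
      | cons hh _ ih =>
        obtain ⟨hne, e, he, h1, h2⟩ := hh
        obtain ⟨m, hm, hj⟩ := hjump _ _ e hne h1 h2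
        rw [dif_neg he] at hj
        exact (sub_eq_zero.mp hj).trans (ih (by rw [← h, cmp_eq R he h1 h2]))
    have hconst : ∀ U, w γ U = w γ U0 := by
      intro U
      by_cases h : cmp R S U = c0
      · exact hcomp _ _ h
      · rw [hcomp U (rep (cmp R S U)) (hrep _).symm]
        exact sub_eq_zero.mp (hγ2 _ h)
    ext ⟨e, he⟩
    obtain ⟨U, U', hne, hb⟩ := R.two e (SimpleGraph.mem_edgeFinset.mp (hS he))
    obtain ⟨m, hm, hj⟩ := hjump U U' e hne ((hb U).mpr (Or.inl rfl)) ((hb U').mpr (Or.inr rfl))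
    rw [dif_pos he, hconst U, hconst U', sub_self] at hj
    rcases mul_eq_zero.mp hj.symm with h | h
    · simpa using h
    · exact absurd h hm
  have hfr := LinearMap.finrank_le_finrank_of_injective hinj
  rw [Module.finrank_prod, Module.finrank_fintype_fun_eq_card, Module.finrank_fintype_fun_eq_card,
    Module.finrank_fintype_fun_eq_card, Fintype.card_coe, Fintype.card_coe, card_erase_of_mem hv0,
    Fintype.card_subtype_compl, Fintype.card_subtype_eq] at hfr
  have p1 : 0 < #(vS S) := card_pos.mpr ⟨v0, hv0⟩
  have p2 : 0 < Fintype.card (dualG R S).ConnectedComponent := Fintype.card_pos_iff.mpr ⟨c0⟩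
  omega

lemma sparse {c : V → Bool} (R : QData G Φ) (hbip : ∀ u v, G.Adj u v → c u ≠ c v)
    {S : Finset (Sym2 V)} (hS : S ⊆ G.edgeFinset) [Nonempty Φ] : #S ≤ 2 * #(vS S) := by
  by_cases hSn : S.Nonempty
  · have h1 := lin_bound R hS hSn
    by_cases h2 : 2 ≤ Fintype.card (dualG R S).ConnectedComponent
    · have := comps_bound R hbip hS h2
      omega
    · omega
  · rw [not_nonempty_iff_eq_empty] at hSn
    simp [hSn]

end Sparse
end QPO

set_option linter.unusedSectionVars false
namespace QPO
open Finset

section Orient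
open scoped Classical
variable {V : Type*} [Fintype V] {G : SimpleGraph V} {Φ : Type} [Fintype Φ] (R : QData G Φ)

lemma exists_two_orientation {c : V → Bool} (R : QData G Φ) [Nonempty Φ]
    (hbip : ∀ u v, G.Adj u v → c u ≠ c v) :
    ∃ o : V → V → Prop, IsOrientation G o ∧ ∀ v, inDeg o v ≤ 2 := by
  let t : G.edgeSet → Finset (V × Bool) := fun e =>
    (univ.filter fun v => v ∈ e.1) ×ˢ (univ : Finset Bool)
  obtain ⟨f, finj, hf⟩ := (Finset.all_card_le_biUnion_card_iff_exists_injective t).mp (by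
    intro s
    let S : Finset (Sym2 V) := s.map (Function.Embedding.subtype _)
    have hS : S ⊆ G.edgeFinset := by
      intro e he
      simp only [S, mem_map, Function.Embedding.subtype_apply] at he
      obtain ⟨e', -, rfl⟩ := he
      exact SimpleGraph.mem_edgeFinset.mpr e'.2
    have h := sparse R hbip hS
    have hb : s.biUnion t = vS S ×ˢ (univ : Finset Bool) := by
      ext ⟨v, i⟩
      simp only [mem_biUnion, t, mem_product, mem_filter, mem_univ, true_and, and_true, vS, S,
        mem_map, Function.Embedding.subtype_apply]
      constructor
      · rintro ⟨e, he, hv⟩; exact ⟨e.1, ⟨e, he, rfl⟩, hv⟩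
      · rintro ⟨_, ⟨e, he, rfl⟩, hv⟩; exact ⟨e, he, hv⟩
    rw [hb, card_product]
    have : #S = #s := card_map _
    simp
    omega)
  have hf1 : ∀ u v (h : G.Adj u v), (f ⟨s(u, v), h⟩).1 = u ∨ (f ⟨s(u, v), h⟩).1 = v := by
    intro u v h
    have := hf ⟨s(u, v), h⟩
    simpa [t] using this
  refine ⟨fun u v => ∃ h : G.Adj u v, (f ⟨s(u, v), h⟩).1 = v, ⟨?_, ?_⟩, ?_⟩
  · intro u v
    constructor
    · intro h
      rcases hf1 u v h with h1 | h1
      · refine Or.inr ⟨h.symm, ?_⟩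
        have : (⟨s(v, u), h.symm⟩ : G.edgeSet) = ⟨s(u, v), h⟩ := Subtype.ext Sym2.eq_swap
        rw [this]; exact h1
      · exact Or.inl ⟨h, h1⟩
    · rintro (⟨h, -⟩ | ⟨h, -⟩)
      · exact h
      · exact h.symm
  · rintro u v ⟨h, h1⟩ ⟨h', h2⟩
    have : (⟨s(v, u), h'⟩ : G.edgeSet) = ⟨s(u, v), h⟩ := Subtype.ext Sym2.eq_swap
    rw [this] at h2
    exact h.ne (h2.symm.trans h1)
  · intro v
    unfold inDeg
    let g : V → Bool := fun u => if h : G.Adj u v then (f ⟨s(u, v), h⟩).2 else false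
    have hinj : Set.InjOn g {u | ∃ h : G.Adj u v, (f ⟨s(u, v), h⟩).1 = v} := by
      rintro u ⟨h, h1⟩ u' ⟨h', h1'⟩ hg
      simp only [g, dif_pos h, dif_pos h'] at hg
      have := finj (Prod.ext (h1.trans h1'.symm) hg)
      have := congrArg Subtype.val this
      simp only [Sym2.eq_iff] at this
      rcases this with h | h
      · exact h.1
      · exact h.1.trans h.2
    have := Set.ncard_le_ncard_of_injOn g (t := Set.univ) (fun _ _ => Set.mem_univ _) hinj
    simpa [Set.ncard_univ] using this

lemma second_part {c : V → Bool} (R : QData G Φ) [Nonempty Φ]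
    (hbip : ∀ u v, G.Adj u v → c u ≠ c v) (hdeg : ∀ v, 3 ≤ (G.neighborSet v).ncard) :
    ∃ o, IsOrientation G o ∧ IsProper G o ∧ ∀ v, inDeg o v ≤ 3 := by
  obtain ⟨o, ⟨ho1, ho2⟩, hin⟩ := exists_two_orientation R hbip
  have hT : ∀ a : V, ∃ T : Set V, {u | o u a} ⊆ T ∧ T ⊆ G.neighborSet a ∧ T.ncard = 3 := by
    intro a
    refine Set.exists_subsuperset_card_eq ?_ ((hin a).trans (by norm_num)) (hdeg a)
    intro u hu
    exact ((ho1 u a).mpr (Or.inl hu)).symm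
  choose T hT1 hT2 hT3 using hT
  let o' : V → V → Prop := fun u v => G.Adj u v ∧ if c v = true then u ∈ T v else v ∉ T u
  have hA : ∀ v, c v = true → inDeg o' v = 3 := by
    intro v hv
    rw [← hT3 v]
    unfold inDeg
    congr 1
    ext u
    simp only [o', hv, if_true, Set.mem_ofPred_eq]
    exact ⟨fun h => h.2, fun h => ⟨(hT2 v h : G.Adj v u).symm, h⟩⟩
  have hB : ∀ v, c v = false → inDeg o' v ≤ 2 := by
    intro v hv
    refine le_trans (Set.ncard_le_ncard ?_ (Set.toFinite _)) (hin v)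
    rintro u ⟨h1, h2⟩
    simp only [hv] at h2
    rcases (ho1 u v).mp h1 with h | h
    · exact h
    · exact absurd (hT1 u h) (by simpa using h2)
  refine ⟨o', ⟨?_, ?_⟩, ?_, ?_⟩
  · intro u v
    constructor
    · intro h
      have hc := hbip u v h
      by_cases hv : c v = true
      · have hu : ¬ c u = true := fun hu => hc (hu.trans hv.symm)
        by_cases hm : u ∈ T v
        · exact Or.inl ⟨h, by rw [if_pos hv]; exact hm⟩
        · exact Or.inr ⟨h.symm, by rw [if_neg hu]; exact hm⟩
      · have hu : c u = true := by
          revert hc hv; cases c u <;> cases c v <;> simp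
        by_cases hm : v ∈ T u
        · exact Or.inr ⟨h.symm, by rw [if_pos hu]; exact hm⟩
        · exact Or.inl ⟨h, by rw [if_neg hv]; exact hm⟩
    · rintro (h | h)
      · exact h.1
      · exact h.1.symm
  · rintro u v ⟨h, h1⟩ ⟨-, h2⟩
    have hc := hbip u v h
    by_cases hv : c v = true
    · have hu : ¬ c u = true := fun hu => hc (hu.trans hv.symm)
      rw [if_pos hv] at h1
      rw [if_neg hu] at h2
      exact h2 h1
    · have hu : c u = true := by
        revert hc hv; cases c u <;> cases c v <;> simp
      rw [if_neg hv] at h1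
      rw [if_pos hu] at h2
      exact h1 h2
  · intro u v h
    have hc := hbip u v h
    cases hu : c u <;> cases hv : c v
    · simp [hu, hv] at hc
    · have := hB u hu; have := hA v hv; omega
    · have := hB v hv; have := hA u hu; omega
    · simp [hu, hv] at hc
  · intro v
    cases hv : c v
    · have := hB v hv; omega
    · have := hA v hv; omega

end Orient
end QPO

set_option linter.unusedSectionVars false
namespace QPO
open Finset

section First
open scoped Classical
variable {V : Type*} [Fintype V] {G : SimpleGraph V} {Φ : Type} [Fintype Φ]

lemma cube_adj (u v : Fin 3 → Bool) :
    cubeGraph.Adj u v ↔ #(univ.filter fun i => u i ≠ v i) = 1 := by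
  have h : ∀ u v : Fin 3 → Bool, ({i | u i ≠ v i} : Set (Fin 3)).ncard =
      #(univ.filter fun i => u i ≠ v i) := by
    intro u v
    rw [← Set.ncard_coe_finset]
    congr 1
    ext i; simp
  unfold cubeGraph
  rw [SimpleGraph.fromRel_adj, h, h]
  constructor
  · rintro ⟨-, h1 | h1⟩
    · exact h1
    · rw [← h1]; congr 1; ext i; simp [ne_comm]
  · intro h1
    refine ⟨?_, Or.inl h1⟩
    rintro rfl
    simp at h1

/-- even vertices of the cube -/
def ev (i : Fin 4) : Fin 3 → Bool :=
  ![![false, false, false], ![false, true, true], ![true, false, true], ![true, true, false]] i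

/-- odd vertices of the cube -/
def od (i : Fin 4) : Fin 3 → Bool := fun j => !(ev i j)

end First

lemma ev_inj : ∀ i j, ev i = ev j → i = j := by decide
lemma od_inj : ∀ i j, od i = od j → i = j := by decide
lemma ev_ne_od : ∀ i j, ev i ≠ od j := by decide
lemma ev_ev : ∀ i j, ¬ #(univ.filter fun k => ev i k ≠ ev j k) = 1 := by decide
lemma od_od : ∀ i j, ¬ #(univ.filter fun k => od i k ≠ od j k) = 1 := by decide
lemma ev_od : ∀ i j, #(univ.filter fun k => ev i k ≠ od j k) = 1 ↔ i ≠ j := by decide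

section First2
open scoped Classical
variable {V : Type*} [Fintype V] {G : SimpleGraph V} {Φ : Type} [Fintype Φ]

lemma cube_ee (i j : Fin 4) : ¬ cubeGraph.Adj (ev i) (ev j) := by
  rw [cube_adj]; convert ev_ev i j
lemma cube_oo (i j : Fin 4) : ¬ cubeGraph.Adj (od i) (od j) := by
  rw [cube_adj]; convert od_od i j
lemma cube_eo (i j : Fin 4) : cubeGraph.Adj (ev i) (od j) ↔ i ≠ j := by
  rw [cube_adj, ← ev_od i j]

lemma iso_cube (S : Finset V) (hS : #S = 4) (hV : Fintype.card V = 8)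
    (hSi : ∀ u ∈ S, ∀ v ∈ S, ¬ G.Adj u v) (hTi : ∀ u ∉ S, ∀ v ∉ S, ¬ G.Adj u v)
    (hd : ∀ v, G.degree v = 3) : Nonempty (G ≃g cubeGraph) := by
  have hnu : ∀ t, ∃ s, t ∉ S → s ∈ S ∧ ∀ s' ∈ S, G.Adj s' t ↔ s' ≠ s := by
    intro t
    by_cases ht : t ∈ S
    · exact ⟨t, fun h => absurd ht h⟩
    have hsub : G.neighborFinset t ⊆ S := by
      intro u hu
      by_contra huS
      exact hTi t ht u huS ((G.mem_neighborFinset t u).mp hu)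
    have hc : #(S \ G.neighborFinset t) = 1 := by
      rw [card_sdiff_of_subset hsub, hS, SimpleGraph.card_neighborFinset_eq_degree, hd]
    obtain ⟨s, hs⟩ := card_eq_one.mp hc
    have hmem : ∀ s', (s' ∈ S ∧ ¬ G.Adj t s') ↔ s' = s := by
      intro s'
      have : s' ∈ S \ G.neighborFinset t ↔ s' ∈ ({s} : Finset V) := by rw [hs]
      simpa using this
    refine ⟨s, fun _ => ⟨((hmem s).mpr rfl).1, ?_⟩⟩
    intro s' hs'
    rw [G.adj_comm, ne_eq, ← hmem s']
    tauto
  choose nu hnu using hnu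
  have hnui : ∀ t ∉ S, ∀ t' ∉ S, nu t = nu t' → t = t' := by
    intro t ht t' ht' h
    by_contra hne
    have hs := (hnu t ht).1
    have hsub : G.neighborFinset (nu t) ⊆ (Sᶜ \ {t, t'}) := by
      intro u hu
      rw [G.mem_neighborFinset] at hu
      have huS : u ∉ S := fun huS => hSi _ hs _ huS hu
      simp only [mem_sdiff, mem_compl, mem_insert, mem_singleton]
      refine ⟨huS, ?_⟩
      rintro (rfl | rfl)
      · exact ((hnu u ht).2 _ hs).mp hu rfl
      · exact ((hnu u ht').2 _ hs).mp hu h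
    have := card_le_card hsub
    rw [SimpleGraph.card_neighborFinset_eq_degree, hd, card_sdiff_of_subset, card_compl, hV, hS,
      card_pair hne] at this
    · omega
    · intro x; simp only [mem_insert, mem_singleton, mem_compl]; rintro (rfl | rfl) <;> assumption
  obtain ⟨σ⟩ : Nonempty (S ≃ Fin 4) := ⟨S.equivFinOfCardEq hS⟩
  let φ : V → (Fin 3 → Bool) := fun v =>
    if h : v ∈ S then ev (σ ⟨v, h⟩) else od (σ ⟨nu v, (hnu v h).1⟩)
  have hinj : Function.Injective φ := by
    intro u v h
    by_cases hu : u ∈ S <;> by_cases hv : v ∈ S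
    · simp only [φ, dif_pos hu, dif_pos hv] at h
      exact congrArg Subtype.val (σ.injective (ev_inj _ _ h))
    · simp only [φ, dif_pos hu, dif_neg hv] at h
      exact absurd h (ev_ne_od _ _)
    · simp only [φ, dif_neg hu, dif_pos hv] at h
      exact absurd h.symm (ev_ne_od _ _)
    · simp only [φ, dif_neg hu, dif_neg hv] at h
      exact hnui u hu v hv (congrArg Subtype.val (σ.injective (od_inj _ _ h)))
  have hbij : Function.Bijective φ := by
    rw [Fintype.bijective_iff_injective_and_card]
    exact ⟨hinj, by rw [hV]; simp⟩
  have hmix : ∀ (u v) (hu : u ∈ S) (hv : v ∉ S), cubeGraph.Adj (φ u) (φ v) ↔ G.Adj u v := by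
    intro u v hu hv
    simp only [φ, dif_pos hu, dif_neg hv]
    rw [cube_eo, (hnu v hv).2 u hu, ne_eq, ne_eq, σ.apply_eq_iff_eq, Subtype.mk.injEq]
  refine ⟨{ toEquiv := Equiv.ofBijective φ hbij, map_rel_iff' := ?_ }⟩
  intro u v
  show cubeGraph.Adj (φ u) (φ v) ↔ G.Adj u v
  by_cases hu : u ∈ S <;> by_cases hv : v ∈ S
  · have := hSi u hu v hv
    simp only [φ, dif_pos hu, dif_pos hv, this, cube_ee]
  · exact hmix u v hu hv
  · rw [SimpleGraph.adj_comm, hmix v u hv hu, SimpleGraph.adj_comm]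
  · have := hTi u hu v hv
    simp only [φ, dif_neg hu, dif_neg hv, this, cube_oo]

lemma first_part {c : V → Bool} (R : QData G Φ) (hconn : G.Connected)
    (hbip : ∀ u v, G.Adj u v → c u ≠ c v) (hdeg : ∀ v, 3 ≤ (G.neighborSet v).ncard)
    (o : V → V → Prop) (ho : IsOrientation G o) (hp : IsProper G o)
    (hin : ∀ v, inDeg o v ≤ 2) : Nonempty (G ≃g cubeGraph) := by
  obtain ⟨ho1, ho2⟩ := ho
  have hd3 : ∀ v, 3 ≤ G.degree v := by
    intro v
    have := hdeg v
    rwa [← G.coe_neighborFinset v, Set.ncard_coe_finset] at this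
  have hi : ∀ v, inDeg o v = #(univ.filter fun u => o u v) := by
    intro v
    unfold inDeg
    rw [← Set.ncard_coe_finset]
    congr 1
    ext u; simp
  have hio : ∀ v, G.degree v = inDeg o v + #(univ.filter fun u => o v u) := by
    intro v
    rw [hi, ← card_union_of_disjoint, ← G.card_neighborFinset_eq_degree]
    · congr 1
      ext u
      simp only [G.mem_neighborFinset, mem_union, mem_filter, mem_univ, true_and]
      rw [ho1 v u]; tauto
    · rw [disjoint_left]
      intro u hu hu'
      simp only [mem_filter, mem_univ, true_and] at hu hu'
      exact ho2 _ _ hu hu'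
  have hsum : ∑ v, inDeg o v = #G.edgeFinset := by
    have h1 := G.sum_degrees_eq_twice_card_edges
    have h2 : ∑ v, inDeg o v = ∑ v, #(univ.filter fun u => o v u) := by
      simp only [hi]
      exact (Finset.sum_card_bipartiteAbove_eq_sum_card_bipartiteBelow
        (s := (univ : Finset V)) (t := (univ : Finset V)) o).symm
    simp only [hio, sum_add_distrib] at h1
    omega
  have hE2 := two_mul_card R
  have hEl := euler_lower R hconn
  have hdsum := G.sum_degrees_eq_twice_card_edges
  set E := #G.edgeFinset with hE
  let S := univ.filter fun v => inDeg o v ≤ 1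
  let T := univ.filter fun v => ¬ inDeg o v ≤ 1
  have hT : ∀ v ∈ T, inDeg o v = 2 := by
    intro v hv
    have h1 := hin v
    have h2 := (mem_filter.mp hv).2
    omega
  have hS : ∀ v ∈ S, inDeg o v ≤ 1 := fun v hv => (mem_filter.mp hv).2
  have hST : ∀ v, v ∉ S → v ∈ T := by
    intro v hv
    simp only [S, T, mem_filter, mem_univ, true_and] at hv ⊢
    exact hv
  have hTS : ∀ v, v ∉ T → v ∈ S := fun v hv => by
    by_contra h; exact hv (hST v h)
  have hn : #S + #T = Fintype.card V := by
    rw [← card_univ]; exact card_filter_add_card_filter_not _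
  have hspl : ∀ f : V → ℕ, ∑ v ∈ S, f v + ∑ v ∈ T, f v = ∑ v, f v := fun f =>
    sum_filter_add_sum_filter_not _ _ _
  have hsS : ∑ v ∈ S, inDeg o v ≤ #S := by
    simpa using sum_le_sum hS
  have hsT : ∑ v ∈ T, inDeg o v = 2 * #T := by
    rw [sum_congr rfl hT]; simp [mul_comm]
  have hs := hspl (inDeg o)
  have hTi : ∀ u ∈ T, ∀ v ∈ T, ¬ G.Adj u v := by
    intro u hu v hv h
    exact hp u v h ((hT u hu).trans (hT v hv).symm)
  have hsub : ∀ t ∈ T, G.neighborFinset t ⊆ S := by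
    intro t ht u hu
    by_contra h
    exact hTi t ht u (hST u h) ((G.mem_neighborFinset t u).mp hu)
  have hdn : 3 * Fintype.card V ≤ 2 * E := by
    rw [← hdsum, ← card_univ]
    have := card_nsmul_le_sum univ (fun v => G.degree v) 3 (fun v _ => hd3 v)
    simpa [mul_comm] using this
  have hne : T.Nonempty := by
    by_contra h
    rw [not_nonempty_iff_eq_empty] at h
    have : #T = 0 := by rw [h]; rfl
    obtain ⟨v⟩ := hconn.nonempty
    have h3 := hd3 v
    have h4 := G.degree_lt_card_verts v
    omega
  obtain ⟨t0, ht0⟩ := hne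
  have hS3 : 3 ≤ #S := by
    have := card_le_card (hsub t0 ht0)
    rw [G.card_neighborFinset_eq_degree] at this
    exact (hd3 t0).trans this
  have hS4 : #S ≤ 4 := by omega
  have hSi : ∀ u ∈ S, ∀ v ∈ S, ¬ G.Adj u v := by
    intro u hu v hv huv
    rcases (show #S = 3 ∨ #S = 4 by omega) with h | h
    · have heq : G.neighborFinset t0 = S := by
        apply eq_of_subset_of_card_le (hsub t0 ht0)
        rw [G.card_neighborFinset_eq_degree, h]; exact hd3 t0
      have a1 : G.Adj t0 u := (G.mem_neighborFinset t0 u).mp (heq ▸ hu)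
      have a2 : G.Adj t0 v := (G.mem_neighborFinset t0 v).mp (heq ▸ hv)
      exact bool_three (hbip _ _ a1) (hbip _ _ a2) (hbip _ _ huv)
    · have hone : ∀ v ∈ S, inDeg o v = 1 := by
        have hle : ∑ v ∈ S, 1 ≤ ∑ v ∈ S, inDeg o v := by simp; omega
        have := (sum_eq_sum_iff_of_le hS).mp (le_antisymm (sum_le_sum hS) hle)
        exact this
      exact hp u v huv ((hone u hu).trans (hone v hv).symm)
  have hdS : ∑ v ∈ S, G.degree v = ∑ v ∈ T, G.degree v := by
    have := Finset.sum_card_bipartiteAbove_eq_sum_card_bipartiteBelow (s := S) (t := T) G.Adj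
    have e1 : ∀ u ∈ S, G.degree u = #(bipartiteAbove G.Adj T u) := by
      intro u hu
      rw [← G.card_neighborFinset_eq_degree]
      congr 1
      ext v
      simp only [G.mem_neighborFinset, bipartiteAbove, mem_filter]
      exact ⟨fun h => ⟨hST v (fun hv => hSi u hu v hv h), h⟩, fun h => h.2⟩
    have e2 : ∀ u ∈ T, G.degree u = #(bipartiteBelow G.Adj S u) := by
      intro u hu
      rw [← G.card_neighborFinset_eq_degree]
      congr 1
      ext v
      simp only [G.mem_neighborFinset, bipartiteBelow, mem_filter]
      exact ⟨fun h => ⟨hTS v (fun hv => hTi u hu v hv h), h.symm⟩, fun h => h.2.symm⟩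
    rw [sum_congr rfl e1, sum_congr rfl e2, this]
  have hds := hspl (fun v => G.degree v)
  have g1 : 3 * #S ≤ ∑ v ∈ S, G.degree v := by
    have := card_nsmul_le_sum S (fun v => G.degree v) 3 (fun v _ => hd3 v)
    simpa [mul_comm] using this
  have g2 : 3 * #T ≤ ∑ v ∈ T, G.degree v := by
    have := card_nsmul_le_sum T (fun v => G.degree v) 3 (fun v _ => hd3 v)
    simpa [mul_comm] using this
  have h4 : #S = 4 := by omega
  have hV : Fintype.card V = 8 := by omega
  refine iso_cube S h4 hV hSi ?_ ?_
  · intro u hu v hv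
    exact hTi u (hST u hu) v (hST v hv)
  · have hle : ∑ v, G.degree v ≤ ∑ v : V, 3 := by
      simp only [sum_const, card_univ, hV, smul_eq_mul]
      omega
    have := (sum_eq_sum_iff_of_le (fun v (_ : v ∈ univ) => hd3 v)).mp
      (le_antisymm (sum_le_sum fun v _ => hd3 v) hle)
    intro v
    exact (this v (mem_univ v)).symm

end First2
end QPO

/-- A bipartite planar quadrangulation with minimum degree at least `3` that is
not isomorphic to `Q₃` has no proper `2`-orientation, and its proper
orientation number equals `3`. -/
theorem quadrangulation_proper_orientation_number {V : Type*} [Fintype V]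
    (G : SimpleGraph V) (hbip : IsBipartite G) (hquad : IsQuadrangulation G)
    (hdeg : ∀ v, 3 ≤ (G.neighborSet v).ncard)
    (hniso : IsEmpty (G ≃g cubeGraph)) :
    (¬ ∃ o, IsOrientation G o ∧ IsProper G o ∧ ∀ v, inDeg o v ≤ 2) ∧
    (∃ o, IsOrientation G o ∧ IsProper G o ∧ ∀ v, inDeg o v ≤ 3) := by
  obtain ⟨c, hc⟩ := hbip
  obtain ⟨Φ, hfin, hne, ⟨R⟩⟩ := QPO.exists_qdata G hquad hdeg
  have : Fintype Φ := Fintype.ofFinite Φ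
  constructor
  · rintro ⟨o, h1, h2, h3⟩
    obtain ⟨i⟩ := QPO.first_part R hquad.1 hc hdeg o h1 h2 h3
    exact hniso.false i
  · exact QPO.second_part R hc hdeg
end

section
/- There exists a simple bipartite planar graph G with minimum degree 2 whose proper orientation number is exactly 4; in particular, G admits no proper orientation with maximum indegree at most 3. -/
inductive W : Type
  | st (y : Bool)
  | pq (i : Fin 4) (y : Bool)
  | d (i : Fin 4) (k : Fin 7)
  | bc (i j : Fin 4) (y : Bool)
  | a (i j : Fin 4) (k : Fin 7)
  deriving DecidableEq, Fintype

namespace W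

/-- The two parents of each vertex other than `s`, `t`. -/
def par : W → Bool → Option W
  | st _, _ => none
  | pq _ _, y => some (st y)
  | d i _, y => some (pq i y)
  | bc i _ _, y => some (pq i y)
  | a i j _, y => some (bc i j y)

def E (u v : W) : Prop := ∃ y, par u y = some v

def col : W → Bool
  | st _ => false
  | pq _ _ => true
  | d _ _ => false
  | bc _ _ _ => false
  | a _ _ _ => true

theorem col_E {u v : W} (h : E u v) : col u ≠ col v := by
  obtain ⟨y, hy⟩ := h
  cases u <;> simp [par] at hy <;> subst hy <;> simp [col]

theorem not_E_symm {u v : W} (h : E u v) (h' : E v u) : False := by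
  obtain ⟨y, hy⟩ := h
  obtain ⟨z, hz⟩ := h'
  cases u <;> simp [par] at hy <;> subst hy <;> simp [par] at hz

def Gr : SimpleGraph W where
  Adj u v := E u v ∨ E v u
  symm := ⟨fun _ _ h => h.symm⟩
  loopless := ⟨fun _ h => not_E_symm (h.elim id id) (h.elim id id)⟩

theorem bip : IsBipartite Gr :=
  ⟨col, fun _ _ h => h.elim col_E fun h => (col_E h).symm⟩

theorem par_mem {u v : W} {y : Bool} (h : par u y = some v) : v ∈ Gr.neighborSet u :=
  Or.inl ⟨y, h⟩

theorem mem_par {u v : W} {y : Bool} (h : par u y = some v) : u ∈ Gr.neighborSet v :=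
  Or.inr ⟨y, h⟩

theorem two_le_of {S : Set W} {u v : W} (hu : u ∈ S) (hv : v ∈ S) (h : u ≠ v) :
    2 ≤ S.ncard := by
  rw [← Set.ncard_pair h]
  exact Set.ncard_le_ncard (by rintro x (rfl | rfl) <;> assumption) (Set.toFinite _)

theorem min_deg (v : W) : 2 ≤ (Gr.neighborSet v).ncard := by
  cases v with
  | st y => exact two_le_of (u := pq 0 false) (v := pq 0 true) (mem_par (y := y) rfl)
              (mem_par (y := y) rfl) (by simp)
  | pq i y => exact two_le_of (par_mem (y := false) rfl) (par_mem (y := true) rfl) (by simp)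
  | d i y => exact two_le_of (par_mem (y := false) rfl) (par_mem (y := true) rfl) (by simp)
  | bc i j y => exact two_le_of (par_mem (y := false) rfl) (par_mem (y := true) rfl) (by simp)
  | a i j y => exact two_le_of (par_mem (y := false) rfl) (par_mem (y := true) rfl) (by simp)

theorem deg_two : (Gr.neighborSet (a 0 0 0)).ncard = 2 := by
  have : Gr.neighborSet (a 0 0 0) = {bc 0 0 false, bc 0 0 true} := by
    ext x
    cases x <;> simp [SimpleGraph.neighborSet, Gr, E, par, eq_comm]
  rw [this, Set.ncard_pair (by simp)]

/-! Proper orientation with maximum indegree 4. -/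

def rev : W → Bool → Bool
  | a _ _ k, y => (k.val == 0 && !y) || (k.val == 1 && y)
  | d _ k, y => (decide (k.val < 2) && !y) || (decide (k.val = 2 ∨ k.val = 3) && y)
  | _, _ => false

def ori (u v : W) : Prop :=
  (∃ y, par u y = some v ∧ rev u y = true) ∨ (∃ y, par v y = some u ∧ rev v y = false)

theorem ori_isOrientation : IsOrientation Gr ori := by
  constructor
  · intro u v
    constructor
    · rintro (⟨y, h⟩ | ⟨y, h⟩) <;> cases hr : rev _ y
      · exact Or.inr (Or.inr ⟨y, h, hr⟩)
      · exact Or.inl (Or.inl ⟨y, h, hr⟩)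
      · exact Or.inl (Or.inr ⟨y, h, hr⟩)
      · exact Or.inr (Or.inl ⟨y, h, hr⟩)
    · rintro ((⟨y, h, -⟩ | ⟨y, h, -⟩) | (⟨y, h, -⟩ | ⟨y, h, -⟩))
      exacts [Or.inl ⟨y, h⟩, Or.inr ⟨y, h⟩, Or.inr ⟨y, h⟩, Or.inl ⟨y, h⟩]
  · have par_inj : ∀ {u v y z}, par u y = some v → par u z = some v → y = z := by
      intro u v y z h h'
      rw [← h] at h'
      cases u <;> simp [par] at h h' <;> exact h'.symm
    rintro u v (⟨y, h, r⟩ | ⟨y, h, r⟩) (⟨z, h', r'⟩ | ⟨z, h', r'⟩)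
    · exact not_E_symm ⟨y, h⟩ ⟨z, h'⟩
    · rw [par_inj h h', r'] at r; cases r
    · rw [par_inj h h', r'] at r; cases r
    · exact not_E_symm ⟨y, h⟩ ⟨z, h'⟩

theorem in_st (y : Bool) : inDeg ori (st y) = 0 := by
  have : {u | ori u (st y)} = ∅ := by
    ext x
    cases x <;> simp [ori, par, rev]
  rw [inDeg, this, Set.ncard_empty]

theorem in_pq (i : Fin 4) (y : Bool) : inDeg ori (pq i y) = 4 := by
  have : {u | ori u (pq i y)} = (({st false, st true, d i (if y then 2 else 0),
      d i (if y then 3 else 1)} : Finset W) : Set W) := by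
    ext x
    cases x with
    | d i' k => fin_cases k <;> cases y <;> simp [ori, par, rev]
    | st z => cases z <;> simp [ori, par, rev]
    | _ => simp [ori, par, rev]
  rw [inDeg, this, Set.ncard_coe_finset]
  cases y <;> simp

theorem in_bc (i j : Fin 4) (y : Bool) : inDeg ori (bc i j y) = 3 := by
  have : {u | ori u (bc i j y)} = (({pq i false, pq i true,
      a i j (if y then 1 else 0)} : Finset W) : Set W) := by
    ext x
    cases x with
    | a i' j' k => fin_cases k <;> cases y <;> simp [ori, par, rev]
    | pq i' z => cases z <;> simp [ori, par, rev] <;> grind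
    | _ => simp [ori, par, rev]
  rw [inDeg, this, Set.ncard_coe_finset]
  cases y <;> simp

theorem ncard_pair_le (u v : W) : ({u, v} : Set W).ncard ≤ 2 :=
  (Set.ncard_insert_le _ _).trans (by simp)

theorem in_d (i : Fin 4) (k : Fin 7) : inDeg ori (d i k) ≤ 2 := by
  refine le_trans (Set.ncard_le_ncard (t := {pq i false, pq i true}) ?_ (Set.toFinite _))
    (ncard_pair_le _ _)
  rintro x (⟨y, h, -⟩ | ⟨y, h, -⟩)
  · cases x <;> simp [par] at h
  · cases y <;> simp [par] at h <;> simp [h]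

theorem in_a (i j : Fin 4) (k : Fin 7) : inDeg ori (a i j k) ≤ 2 := by
  refine le_trans (Set.ncard_le_ncard (t := {bc i j false, bc i j true}) ?_ (Set.toFinite _))
    (ncard_pair_le _ _)
  rintro x (⟨y, h, -⟩ | ⟨y, h, -⟩)
  · cases x <;> simp [par] at h
  · cases y <;> simp [par] at h <;> simp [h]

theorem ori_le (v : W) : inDeg ori v ≤ 4 := by
  cases v with
  | st y => simp [in_st]
  | pq i y => simp [in_pq]
  | bc i j y => simp [in_bc]
  | d i k => have := in_d i k; omega
  | a i j k => have := in_a i j k; omega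

theorem ori_E {u v : W} (h : E u v) : inDeg ori u ≠ inDeg ori v := by
  obtain ⟨y, hy⟩ := h
  cases u with
  | st y => simp [par] at hy
  | pq i y => simp [par] at hy; subst hy; simp [in_st, in_pq]
  | bc i j y => simp [par] at hy; subst hy; simp [in_bc, in_pq]
  | d i k => simp [par] at hy; subst hy; have := in_d i k; rw [in_pq]; omega
  | a i j k => simp [par] at hy; subst hy; have := in_a i j k; rw [in_bc]; omega

theorem ori_proper : IsProper Gr ori :=
  fun _ _ h => h.elim ori_E fun h => (ori_E h).symm

/-! No proper orientation with maximum indegree 3. -/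

theorem pigeon {o : W → W → Prop} (ho : IsOrientation Gr o) (h3 : ∀ v, inDeg o v ≤ 3)
    {ι : Type} [Fintype ι] (hc : 7 ≤ Fintype.card ι) (f : ι → W) (hf : Function.Injective f)
    (P : Bool → W) (hP : ∀ k y, par (f k) y = some (P y)) :
    ∃ k, ∀ y, o (P y) (f k) := by
  classical
  by_contra! hcon
  have key : ∀ y, (Finset.univ.filter fun k => o (f k) (P y)).card ≤ 3 := by
    intro y
    refine le_trans ?_ (h3 (P y))
    rw [← Finset.card_image_of_injective _ hf, ← Set.ncard_coe_finset]
    refine Set.ncard_le_ncard ?_ (Set.toFinite _)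
    intro x hx
    simp only [Finset.coe_image, Set.mem_image, Finset.coe_filter, Set.mem_ofPred_eq] at hx
    obtain ⟨k, hk, rfl⟩ := hx
    exact hk.2
  have hU : (Finset.univ : Finset ι) ⊆ (Finset.univ.filter fun k => o (f k) (P false)) ∪
      (Finset.univ.filter fun k => o (f k) (P true)) := by
    intro k _
    obtain ⟨y, hy⟩ := hcon k
    have h1 := (ho.1 (f k) (P y)).1 (Or.inl ⟨y, hP k y⟩)
    have h2 : o (f k) (P y) := h1.resolve_right hy
    cases y <;> simp [h2]
  have h1 := Finset.card_le_card hU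
  have h2 := Finset.card_union_le (Finset.univ.filter fun k => o (f k) (P false))
    (Finset.univ.filter fun k => o (f k) (P true))
  have h3 := key false
  have h4 := key true
  rw [Finset.card_univ] at h1
  omega

theorem no_three : ¬ ∃ o, IsOrientation Gr o ∧ IsProper Gr o ∧ ∀ v, inDeg o v ≤ 3 := by
  rintro ⟨o, ho, hp, h3⟩
  have adj : ∀ {u v}, o u v → Gr.Adj u v := fun h => (ho.1 _ _).2 (Or.inl h)
  have bc2 : ∀ i j y, inDeg o (bc i j y) ≠ 2 := by
    intro i j y
    obtain ⟨k, hk⟩ := pigeon ho h3 (ι := Fin 7) (by simp) (fun k => a i j k)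
      (fun _ _ h => by simpa using h) (fun y => bc i j y) (fun _ _ => rfl)
    have h2 : inDeg o (a i j k) = 2 := by
      apply le_antisymm
      · refine le_trans (Set.ncard_le_ncard (t := {bc i j false, bc i j true}) ?_
          (Set.toFinite _)) (ncard_pair_le _ _)
        intro x hx
        rcases adj hx with ⟨y, h⟩ | ⟨y, h⟩
        · cases x <;> simp [par] at h
        · cases y <;> simp [par] at h <;> simp [h]
      · exact two_le_of (hk false) (hk true) (by simp)
    rw [← h2]
    exact hp _ _ (adj (hk y))
  have pq2 : ∀ i y, inDeg o (pq i y) ≠ 2 := by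
    intro i y
    obtain ⟨k, hk⟩ := pigeon ho h3 (ι := Fin 7) (by simp) (fun k => d i k)
      (fun _ _ h => by simpa using h) (fun y => pq i y) (fun _ _ => rfl)
    have h2 : inDeg o (d i k) = 2 := by
      apply le_antisymm
      · refine le_trans (Set.ncard_le_ncard (t := {pq i false, pq i true}) ?_
          (Set.toFinite _)) (ncard_pair_le _ _)
        intro x hx
        rcases adj hx with ⟨y, h⟩ | ⟨y, h⟩
        · cases x <;> simp [par] at h
        · cases y <;> simp [par] at h <;> simp [h]
      · exact two_le_of (hk false) (hk true) (by simp)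
    rw [← h2]
    exact hp _ _ (adj (hk y))
  have pq3 : ∀ i y, inDeg o (pq i y) ≠ 3 := by
    intro i y
    obtain ⟨k, hk⟩ := pigeon ho h3 (ι := Fin 4 × Bool) (by simp) (fun k => bc i k.1 k.2)
      (fun _ _ h => by simpa [Prod.ext_iff] using h) (fun y => pq i y) (fun _ _ => rfl)
    have h2 : 2 ≤ inDeg o (bc i k.1 k.2) := two_le_of (hk false) (hk true) (by simp)
    have h3' := h3 (bc i k.1 k.2)
    have h4 := bc2 i k.1 k.2
    have h5 := hp _ _ (adj (hk y))
    omega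
  obtain ⟨k, hk⟩ := pigeon ho h3 (ι := Fin 4 × Bool) (by simp) (fun k => pq k.1 k.2)
      (fun _ _ h => by simpa [Prod.ext_iff] using h) (fun y => st y) (fun _ _ => rfl)
  have h2 : 2 ≤ inDeg o (pq k.1 k.2) := two_le_of (hk false) (hk true) (by simp)
  have h3' := h3 (pq k.1 k.2)
  have h4 := pq2 k.1 k.2
  have h5 := pq3 k.1 k.2
  omega

/-! Planarity: a straight line drawing with natural coordinates. -/

def cx : W → ℕ
  | st _ => 475
  | pq i y => 250 * i.val + cond y 200 0
  | d i _ => 250 * i.val + 100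
  | bc i _ _ => 250 * i.val + 100
  | a i _ k => 250 * i.val + 101 + k.val

def cy : W → ℕ
  | st y => cond y 800 0
  | pq _ _ => 400
  | d _ k => 399 - k.val
  | bc _ j y => 401 + 3 * j.val + cond y 2 0
  | a _ j _ => 402 + 3 * j.val

theorem coord_inj {u v : W} (hx : cx u = cx v) (hy : cy u = cy v) : u = v := by
  cases u <;> cases v <;> simp only [cx, cy] at hx hy <;>
    simp only [st.injEq, pq.injEq, d.injEq, bc.injEq, a.injEq, reduceCtorEq, Fin.ext_iff] <;>
    grind

def pos (ax ay bx b_y px py : ℕ) : ℕ := bx * py + b_y * ax + ay * px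
def neg (ax ay bx b_y px py : ℕ) : ℕ := bx * ay + ax * py + b_y * px

def peq (ax ay bx b_y : ℕ) : Bool := Nat.beq ax bx && Nat.beq ay b_y

/-- Signs of the two ends `C`, `D` with respect to the line `AB`. -/
def sepAux (l1 r1 l2 r2 : ℕ) (c1 c2 : Bool) : Bool :=
  (Nat.blt r1 l1 && Nat.blt r2 l2) || (Nat.blt l1 r1 && Nat.blt l2 r2) ||
  (c1 && !(Nat.beq l2 r2)) || (c2 && !(Nat.beq l1 r1))

def sep (ax ay bx b_y px py qx qy : ℕ) : Bool :=
  sepAux (pos ax ay bx b_y px py) (neg ax ay bx b_y px py)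
    (pos ax ay bx b_y qx qy) (neg ax ay bx b_y qx qy)
    (peq px py ax ay || peq px py bx b_y) (peq qx qy ax ay || peq qx qy bx b_y)

def ok (ax ay bx b_y px py qx qy : ℕ) : Bool :=
  (Nat.blt ax px && Nat.blt ax qx && Nat.blt bx px && Nat.blt bx qx) ||
  sep ax ay bx b_y px py qx qy || sep px py qx qy ax ay bx b_y

def l4 : List (Fin 4) := [0, 1, 2, 3]
def l7 : List (Fin 7) := [0, 1, 2, 3, 4, 5, 6]
def l2 : List Bool := [false, true]

def edges : List (W × W) :=
  l4.flatMap fun i => l2.flatMap fun y =>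
    l2.map (fun x => (pq i x, st y)) ++ l7.map (fun k => (d i k, pq i y)) ++
    l4.flatMap fun j => l2.map (fun x => (bc i j x, pq i y)) ++ l7.map (fun k => (a i j k, bc i j y))

/-- Quadruple of coordinates of an edge. -/
def quad (e : W × W) : ℕ × ℕ × ℕ × ℕ := (cx e.1, cy e.1, cx e.2, cy e.2)

def check : List (ℕ × ℕ × ℕ × ℕ) → Bool
  | [] => true
  | (ax, ay, bx, b_y) :: L =>
    (L.all fun (px, py, qx, qy) => ok ax ay bx b_y px py qx qy) && check L

theorem check_quads : check (edges.map quad) = true := by decide +kernel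

def pt (x y : ℕ) : ℝ × ℝ := (x, y)

/-- Two segments meet only in common endpoints. -/
def Good (A B C D : ℝ × ℝ) : Prop :=
  segment ℝ A B ∩ segment ℝ C D ⊆ ({A, B} : Set (ℝ × ℝ)) ∩ {C, D}

theorem Good.swap {A B C D : ℝ × ℝ} (h : Good A B C D) : Good C D A B :=
  fun _ hx => (h hx.symm).symm

theorem Good.left {A B C D : ℝ × ℝ} (h : Good A B C D) : Good B A C D := by
  unfold Good at *
  rwa [segment_symm, Set.pair_comm]

theorem Good.right {A B C D : ℝ × ℝ} (h : Good A B C D) : Good A B D C :=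
  h.swap.left.swap

theorem seg_end {α β t : ℝ} (ht0 : 0 ≤ t) (ht1 : t ≤ 1) (h : (1 - t) * α + t * β = 0)
    (h' : (0 < α ∧ 0 < β) ∨ (α < 0 ∧ β < 0)) : False := by
  have h1 : 0 ≤ 1 - t := by linarith
  rcases h' with ⟨ha, hb⟩ | ⟨ha, hb⟩
  · rcases ht0.eq_or_lt with rfl | ht
    · linarith
    · nlinarith [mul_pos ht hb, mul_nonneg h1 ha.le]
  · rcases ht0.eq_or_lt with rfl | ht
    · linarith
    · nlinarith [mul_neg_of_pos_of_neg ht hb, mul_nonneg h1 (neg_pos.2 ha).le]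

theorem peq_iff {ax ay bx b_y : ℕ} (h : peq ax ay bx b_y = true) : ax = bx ∧ ay = b_y := by
  simpa [peq] using h

theorem sep_sound {ax ay bx b_y px py qx qy : ℕ} (h : sep ax ay bx b_y px py qx qy = true) :
    Good (pt ax ay) (pt bx b_y) (pt px py) (pt qx qy) := by
  rintro ⟨X, Y⟩ ⟨hP, hQ⟩
  rw [segment_eq_image] at hP hQ
  obtain ⟨s, ⟨hs0, hs1⟩, hs⟩ := hP
  obtain ⟨t, ⟨ht0, ht1⟩, ht⟩ := hQ
  simp only [pt, Prod.smul_mk, Prod.mk_add_mk, smul_eq_mul, Prod.mk.injEq] at hs ht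
  obtain ⟨hsx, hsy⟩ := hs
  obtain ⟨htx, hty⟩ := ht
  set α : ℝ := (pos ax ay bx b_y px py : ℝ) - neg ax ay bx b_y px py with hα
  set β : ℝ := (pos ax ay bx b_y qx qy : ℝ) - neg ax ay bx b_y qx qy with hβ
  have key : (1 - t) * α + t * β = 0 := by
    have e : (1 - t) * α + t * β = (bx * Y + b_y * ax + ay * X) - (bx * ay + ax * Y + b_y * X) := by
      rw [hα, hβ, ← htx, ← hty]
      simp only [pos, neg]
      push_cast
      ring
    rw [e, ← hsx, ← hsy]
    ring
  -- the two possible touching cases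
  have caseC : (peq px py ax ay = true ∨ peq px py bx b_y = true) → β ≠ 0 →
      ((X, Y) : ℝ × ℝ) ∈ ({pt ax ay, pt bx b_y} : Set (ℝ × ℝ)) ∩ {pt px py, pt qx qy} := by
    intro hc hb
    have hα0 : α = 0 := by
      rcases hc with hc | hc <;> obtain ⟨rfl, rfl⟩ := peq_iff hc <;> rw [hα] <;>
        simp only [pos, neg] <;> push_cast <;> ring
    have ht : t = 0 := by
      rw [hα0] at key
      simpa [hb] using key
    subst ht
    have hP : ((X, Y) : ℝ × ℝ) = pt px py := by
      simp only [pt, Prod.mk.injEq]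
      exact ⟨by linarith, by linarith⟩
    rw [hP]
    rcases hc with hc | hc <;> obtain ⟨rfl, rfl⟩ := peq_iff hc <;> simp
  have caseD : (peq qx qy ax ay = true ∨ peq qx qy bx b_y = true) → α ≠ 0 →
      ((X, Y) : ℝ × ℝ) ∈ ({pt ax ay, pt bx b_y} : Set (ℝ × ℝ)) ∩ {pt px py, pt qx qy} := by
    intro hc hb
    have hβ0 : β = 0 := by
      rcases hc with hc | hc <;> obtain ⟨rfl, rfl⟩ := peq_iff hc <;> rw [hβ] <;>
        simp only [pos, neg] <;> push_cast <;> ring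
    have ht : t = 1 := by
      rw [hβ0] at key
      have : 1 - t = 0 := by simpa [hb] using key
      linarith
    subst ht
    have hP : ((X, Y) : ℝ × ℝ) = pt qx qy := by
      simp only [pt, Prod.mk.injEq]
      exact ⟨by linarith, by linarith⟩
    rw [hP]
    rcases hc with hc | hc <;> obtain ⟨rfl, rfl⟩ := peq_iff hc <;> simp
  simp only [sep, sepAux, Bool.or_eq_true, Bool.and_eq_true, Nat.blt_eq] at h
  rcases h with ((⟨h1, h2⟩ | ⟨h1, h2⟩) | ⟨h1, h2⟩) | ⟨h1, h2⟩
  · refine (seg_end ht0 ht1 key (Or.inl ⟨?_, ?_⟩)).elim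
    · rw [hα, sub_pos]; exact_mod_cast h1
    · rw [hβ, sub_pos]; exact_mod_cast h2
  · refine (seg_end ht0 ht1 key (Or.inr ⟨?_, ?_⟩)).elim
    · rw [hα, sub_neg]; exact_mod_cast h1
    · rw [hβ, sub_neg]; exact_mod_cast h2
  · refine caseC h1 ?_
    rw [hβ, sub_ne_zero]
    intro h0
    have h0' := Nat.cast_injective h0
    simp [h0'] at h2
  · refine caseD h1 ?_
    rw [hα, sub_ne_zero]
    intro h0
    have h0' := Nat.cast_injective h0
    simp [h0'] at h2

theorem ok_sound {ax ay bx b_y px py qx qy : ℕ} (h : ok ax ay bx b_y px py qx qy = true) :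
    Good (pt ax ay) (pt bx b_y) (pt px py) (pt qx qy) := by
  simp only [ok, Bool.or_eq_true] at h
  rcases h with (h | h) | h
  · simp only [Bool.and_eq_true, Nat.blt_eq] at h
    obtain ⟨⟨⟨h1, h2⟩, h3⟩, h4⟩ := h
    rintro ⟨X, Y⟩ ⟨hP, hQ⟩
    exfalso
    rw [segment_eq_image] at hP hQ
    obtain ⟨s, ⟨hs0, hs1⟩, hs⟩ := hP
    obtain ⟨t, ⟨ht0, ht1⟩, ht⟩ := hQ
    simp only [pt, Prod.smul_mk, Prod.mk_add_mk, smul_eq_mul, Prod.mk.injEq] at hs ht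
    have g1 : (ax : ℝ) < px := by exact_mod_cast h1
    have g2 : (ax : ℝ) < qx := by exact_mod_cast h2
    have g3 : (bx : ℝ) < px := by exact_mod_cast h3
    have g4 : (bx : ℝ) < qx := by exact_mod_cast h4
    have u1 : X ≤ max (ax : ℝ) bx := by
      rw [← hs.1]
      nlinarith [le_max_left (ax : ℝ) bx, le_max_right (ax : ℝ) bx]
    have u2 : min (px : ℝ) qx ≤ X := by
      rw [← ht.1]
      nlinarith [min_le_left (px : ℝ) qx, min_le_right (px : ℝ) qx]
    have u3 : max (ax : ℝ) bx < min (px : ℝ) qx := by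
      simp [g1, g2, g3, g4]
    linarith
  · exact sep_sound h
  · exact (sep_sound h).swap

theorem check_sound : ∀ {L : List (ℕ × ℕ × ℕ × ℕ)}, check L = true →
    L.Pairwise fun e f => Good (pt e.1 e.2.1) (pt e.2.2.1 e.2.2.2) (pt f.1 f.2.1)
      (pt f.2.2.1 f.2.2.2)
  | [], _ => List.Pairwise.nil
  | (ax, ay, bx, b_y) :: L, h => by
    rw [check, Bool.and_eq_true, List.all_eq_true] at h
    refine List.Pairwise.cons (fun f hf => ok_sound (h.1 f hf)) (check_sound h.2)

theorem mem_l4 (i : Fin 4) : i ∈ l4 := by revert i; decide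
theorem mem_l7 (i : Fin 7) : i ∈ l7 := by revert i; decide
theorem mem_l2 (i : Bool) : i ∈ l2 := by revert i; decide

theorem mem_edges {u v : W} (h : E u v) : (u, v) ∈ edges := by
  obtain ⟨y, hy⟩ := h
  cases u <;> simp [par] at hy <;> subst hy <;>
    simp [edges, mem_l2, mem_l4, mem_l7]

noncomputable def pv (w : W) : ℝ × ℝ := pt (cx w) (cy w)

theorem pv_inj : Function.Injective pv := by
  intro u v h
  simp only [pv, pt, Prod.mk.injEq, Nat.cast_inj] at h
  exact coord_inj h.1 h.2

theorem good_list (L : List (W × W)) (hL : check (L.map quad) = true) {e f : W × W}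
    (he : e ∈ L) (hf : f ∈ L) (hne : e ≠ f) : Good (pv e.1) (pv e.2) (pv f.1) (pv f.2) := by
  have H := check_sound hL
  rw [List.pairwise_map] at H
  have : Std.Symm (fun e f : W × W => e ≠ f → Good (pv e.1) (pv e.2) (pv f.1) (pv f.2)) :=
    ⟨fun e f hef hne => (hef hne.symm).swap⟩
  have H1 : L.Pairwise (fun e f : W × W => e ≠ f →
      Good (pv e.1) (pv e.2) (pv f.1) (pv f.2)) := by
    refine H.imp ?_
    intro e f hg _
    exact hg
  exact List.Pairwise.forall_of_forall
    (R := fun e f : W × W => e ≠ f → Good (pv e.1) (pv e.2) (pv f.1) (pv f.2))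
    (fun e _ he => (he rfl).elim) H1 he hf hne

theorem good_E {u v u' v' : W} (h : E u v) (h' : E u' v') (hne : s(u, v) ≠ s(u', v')) :
    Good (pv u) (pv v) (pv u') (pv v') := by
  have hn : (u, v) ≠ (u', v') := by
    intro he
    simp only [Prod.mk.injEq] at he
    exact hne (by rw [he.1, he.2])
  have key := good_list edges check_quads (e := (u, v)) (f := (u', v')) (mem_edges h)
    (mem_edges h') hn
  exact key

theorem good_adj {u v u' v' : W} (h : Gr.Adj u v) (h' : Gr.Adj u' v')
    (hne : s(u, v) ≠ s(u', v')) : Good (pv u) (pv v) (pv u') (pv v') := by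
  rcases h with h | h <;> rcases h' with h' | h'
  · exact good_E h h' hne
  · exact (good_E h h' (by rwa [Sym2.eq_swap (a := v')])).right
  · exact (good_E h h' (by rwa [Sym2.eq_swap (a := v)])).left
  · exact (good_E h h' (by rwa [Sym2.eq_swap (a := v), Sym2.eq_swap (a := v')])).left.right

theorem exists_nbr (w : W) : ∃ w', Gr.Adj w w' := by
  have h := min_deg w
  have : (Gr.neighborSet w).Nonempty := by
    rw [Set.nonempty_iff_ne_empty]
    intro h0
    simp [h0] at h
  exact this

theorem planar : IsPlanar Gr := by
  refine ⟨{
    vert := pv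
    vert_inj := pv_inj
    arc := fun u v _ => Path.segment (pv u) (pv v)
    arc_inj := fun u v h => Path.segment_injective_of_ne (pv_inj.ne h.ne)
    arc_symm := fun u v h => by rw [Path.range_segment, Path.range_segment, segment_symm]
    arc_vert := ?_
    arc_disjoint := ?_ }⟩
  · intro u v h w hw
    rw [Path.range_segment] at hw
    by_contra! hcon
    obtain ⟨w', hw'⟩ := exists_nbr w
    have hg := good_adj h hw' (by
      intro he
      have : w ∈ s(u, v) := by rw [he]; simp
      simp [hcon.1, hcon.2] at this)
    have := (hg ⟨hw, left_mem_segment ℝ _ _⟩).1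
    simp only [Set.mem_insert_iff, Set.mem_singleton_iff, pv_inj.eq_iff] at this
    tauto
  · intro u v u' v' h h' hne
    rw [Path.range_segment, Path.range_segment]
    exact good_adj h h' hne

end W

/-- There is a simple bipartite planar graph with minimum degree `2` whose
proper orientation number is exactly `4`: it has a proper `4`-orientation but
no proper `3`-orientation. -/
theorem exists_bipartite_planar_pon_four :
    ∃ (V : Type) (_ : Fintype V) (G : SimpleGraph V),
      IsBipartite G ∧ IsPlanar G ∧
      (∀ v, 2 ≤ (G.neighborSet v).ncard) ∧
      (∃ v, (G.neighborSet v).ncard = 2) ∧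
      (∃ o, IsOrientation G o ∧ IsProper G o ∧ ∀ v, inDeg o v ≤ 4) ∧
      ¬ ∃ o, IsOrientation G o ∧ IsProper G o ∧ ∀ v, inDeg o v ≤ 3 := by
  exact ⟨W, inferInstance, W.Gr, W.bip, W.planar, W.min_deg, ⟨_, W.deg_two⟩,
    ⟨W.ori, W.ori_isOrientation, W.ori_proper, W.ori_le⟩, W.no_three⟩
end
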